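/- Suppose 𝔣 is continuous of bounded variation with ∫_𝕋 𝔣(x) dx = 0, and let μ_* be the unique stationary measure of the transition kernel p(x,·) = 𝔭(x)δ_{x+α} + 𝔮(x)δ_{x−α}. Then for every continuous φ : 𝕋 → ℝ and every ε > 0 there exists q₀ such that sup_{x∈𝕋} |∫_𝕋 φ dν_{x,q}^{odd} − ∫_𝕋 φ dμ_*| < ε and sup_{x∈𝕋} |∫_𝕋 φ dν_{x,q}^{even} − ∫_𝕋 φ dμ_*| < ε for every close return time q of α with q ≥ q₀. -/

import Mathlib

open MeasureTheory Filter Finset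

noncomputable section

attribute [local instance] Classical.propDecidable

/-- The point `x + j·α` on the circle `𝕋 = ℝ/ℤ`. -/
def pt (α : ℝ) (x : UnitAddCircle) (j : ℤ) : UnitAddCircle :=
  x + (((j : ℝ) * α : ℝ) : UnitAddCircle)

/-- One-step transition probability of the random walk on `ℤ` in the quasi-periodic
environment `(𝔭, α, x)`: from `j` it jumps to `j+1` with probability `𝔭(x+jα)` and to
`j-1` with probability `𝔮(x+jα) = 1-𝔭(x+jα)`. -/
def stepProb (𝔭 : UnitAddCircle → ℝ) (α : ℝ) (x : UnitAddCircle) (j j' : ℤ) : ℝ :=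
  if j' = j + 1 then 𝔭 (pt α x j) else if j' = j - 1 then 1 - 𝔭 (pt α x j) else 0

/-- `ξ` is (a version of) the random walk on `ℤ` in the quasi-periodic environment
`(𝔭, α, x)` started at `start`, defined on the probability space `(Ω, ℙ)`; this is
expressed through its finite-dimensional distributions. -/
def IsQPWalk (𝔭 : UnitAddCircle → ℝ) (α : ℝ) (x : UnitAddCircle) (start : ℤ)
    {Ω : Type} [MeasurableSpace Ω] (ℙ : Measure Ω) (ξ : ℕ → Ω → ℤ) : Prop :=
  IsProbabilityMeasure ℙ ∧ (∀ n, Measurable (ξ n)) ∧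
  ∀ (n : ℕ) (k : ℕ → ℤ),
    ℙ {ω | ∀ i ≤ n, ξ i ω = k i} =
      ENNReal.ofReal ((if k 0 = start then (1 : ℝ) else 0) *
        ∏ i ∈ Finset.range n, stepProb 𝔭 α x (k i) (k (i + 1)))

/-- `𝔣` is continuous, of bounded variation, with `∫_𝕋 𝔣(z) dz = 0`. -/
def ZeroMeanBV (𝔣 : UnitAddCircle → ℝ) : Prop :=
  Continuous 𝔣 ∧ BoundedVariationOn (fun t : ℝ => 𝔣 (t : UnitAddCircle)) (Set.Icc 0 1) ∧
    ∫ z : UnitAddCircle, 𝔣 z = 0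

/-- The function `𝔭 = e^𝔣/(1+e^𝔣)` associated to `𝔣`. -/
def pOf (𝔣 : UnitAddCircle → ℝ) : UnitAddCircle → ℝ :=
  fun z => Real.exp (𝔣 z) / (1 + Real.exp (𝔣 z))

/-- The event that `ξ_n = a` and `ξ_i ≠ 0` for all `1 ≤ i < n`, i.e. a visit to `a` at
time `n` before the first return to `0`. -/
def firstRetSet {Ω : Type} (ξ : ℕ → Ω → ℤ) (n : ℕ) (a : ℤ) : Set Ω :=
  {ω | (∀ i, 1 ≤ i → i < n → ξ i ω ≠ 0) ∧ ξ n ω = a}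

/-- `μ_{x,a} = Σ_{n≥1} ℙ_x(ξ_1 ≠ 0, …, ξ_{n-1} ≠ 0, ξ_n = a)`, the expected number of
visits of `(ξ_n)` to `a` before the first return to `0`. -/
def muW {Ω : Type} [MeasurableSpace Ω] (ℙ : Measure Ω) (ξ : ℕ → Ω → ℤ) (a : ℤ) : ℝ :=
  ∑' n : ℕ, (ℙ (firstRetSet ξ (n + 1) a)).toReal

/-- `q` is a close return time of `α`: `q` is the denominator of a rational
approximation with `|α - p/q| < 1/q²`. -/
def CloseReturnTime (α : ℝ) (q : ℕ) : Prop :=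
  0 < q ∧ ∃ p : ℤ, |α - (p : ℝ) / (q : ℝ)| < 1 / (q : ℝ) ^ 2

/-- The Markov operator associated to the transition kernel
`p(x,·) = 𝔭(x) δ_{x+α} + (1-𝔭(x)) δ_{x-α}`, acting on Borel measures on the circle:
`(Pν)(A) = ∫ p(x,A) ν(dx)`. -/
def Pop (𝔭 : UnitAddCircle → ℝ) (α : ℝ) (ν : Measure UnitAddCircle) :
    Measure UnitAddCircle :=
  (ν.withDensity fun z => ENNReal.ofReal (𝔭 z)).map
      (fun z => z + ((α : ℝ) : UnitAddCircle)) +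
    (ν.withDensity fun z => ENNReal.ofReal (1 - 𝔭 z)).map
      (fun z => z - ((α : ℝ) : UnitAddCircle))

/-- `μ` is the unique stationary (invariant) probability measure of the kernel
`p(x,·) = 𝔭(x) δ_{x+α} + (1-𝔭(x)) δ_{x-α}`. -/
def IsUniqueStationary (𝔭 : UnitAddCircle → ℝ) (α : ℝ) (μ : Measure UnitAddCircle) : Prop :=
  IsProbabilityMeasure μ ∧ Pop 𝔭 α μ = μ ∧
    ∀ ν : Measure UnitAddCircle, IsProbabilityMeasure ν → Pop 𝔭 α ν = ν → ν = μ


def QPv (v : ℝ → ℝ) (V : ℝ) (g : UnitAddCircle → ℝ) : Prop :=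
  (∀ t, v (t + 1) = v t + V) ∧
    ∀ u w : ℝ, u ≤ w → |g (u : UnitAddCircle) - g (w : UnitAddCircle)| ≤ v w - v u

def GoodApp (β : ℝ) (p : ℤ) (s : ℕ) : Prop :=
  0 < s ∧ IsCoprime p (s : ℤ) ∧ |β - (p : ℝ) / (s : ℝ)| < 1 / (s : ℝ) ^ 2

lemma sum_perm_aux (s : ℕ) (hs : 0 < s) (p : ℤ) (hp : IsCoprime p (s : ℤ)) (F : ℤ → ℝ)
    (hF : ∀ j, F (j + s) = F j) :
    ∑ i ∈ range s, F ((i : ℤ) * p) = ∑ j ∈ range s, F (j : ℤ) := by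
  have hs' : (s : ℤ) ≠ 0 := by exact_mod_cast hs.ne'
  have hper : Function.Periodic F (s : ℤ) := hF
  have hmod : ∀ j : ℤ, F (j % (s : ℤ)) = F j := by
    intro j
    have h := hper.int_mul (j / s) (j % s)
    have h' : j % (s : ℤ) + ((j / (s : ℤ) : ℤ) : ℤ) * (s : ℤ) = j := by
      rw [mul_comm]; exact Int.emod_add_mul_ediv j s
    simp only [Int.cast_id] at h
    rw [h'] at h
    exact h.symm
  have hnn : ∀ j : ℤ, 0 ≤ j % (s : ℤ) := fun j => Int.emod_nonneg j hs'
  have hlt : ∀ j : ℤ, j % (s : ℤ) < s := fun j => Int.emod_lt_of_pos j (by exact_mod_cast hs)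
  let e : ℕ → ℕ := fun i => (((i : ℤ) * p) % (s : ℤ)).toNat
  have he : ∀ i, ((e i : ℕ) : ℤ) = ((i : ℤ) * p) % (s : ℤ) := fun i => Int.toNat_of_nonneg (hnn _)
  have hmaps : ∀ i ∈ range s, e i ∈ range s := by
    intro i _
    rw [mem_range]
    have := hlt ((i : ℤ) * p)
    rw [← he i] at this
    exact_mod_cast this
  have hinj : Set.InjOn e (range s : Finset ℕ) := by
    intro i hi j hj hij
    have h1 : ((i : ℤ) * p) % (s : ℤ) = ((j : ℤ) * p) % (s : ℤ) := by
      rw [← he, ← he, hij]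
    have h2 : (s : ℤ) ∣ ((j : ℤ) - i) * p := by
      have := Int.emod_emod_of_dvd
      have h3 := (Int.emod_eq_emod_iff_emod_sub_eq_zero.mp h1.symm)
      rw [← sub_mul] at h3
      exact Int.dvd_of_emod_eq_zero h3
    have h4 : (s : ℤ) ∣ ((j : ℤ) - i) := hp.symm.dvd_of_dvd_mul_right h2
    simp only [coe_range, Set.mem_Iio] at hi hj
    have h5 : ((j : ℤ) - i) = 0 := by
      apply Int.eq_zero_of_abs_lt_dvd h4
      rw [abs_lt]; constructor <;> omega
    omega
  have himg : (range s).image e = range s := by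
    apply Finset.eq_of_subset_of_card_le
    · intro k hk
      obtain ⟨i, hi, rfl⟩ := mem_image.mp hk
      exact hmaps i hi
    · rw [card_image_of_injOn hinj]
  conv_rhs => rw [← himg, sum_image hinj]
  refine sum_congr rfl fun i _ => ?_
  rw [he, hmod]

lemma tele_aux (s : ℕ) (hs : 0 < s) (p : ℤ) (hp : IsCoprime p (s : ℤ)) (v : ℝ → ℝ) (V : ℝ)
    (hv : ∀ t, v (t + 1) = v t + V) (R : ℕ) (y : ℝ) :
    ∑ i ∈ range s, (v (y + i * (p / s : ℝ) + R / s) - v (y + i * (p / s : ℝ) - R / s))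
      = 2 * R * V := by
  have hs' : (s : ℝ) ≠ 0 := by exact_mod_cast hs.ne'
  let H : ℤ → ℝ := fun j => v (y + j / s)
  have hH : ∀ j, H (j + s) = H j + V := by
    intro j
    simp only [H]
    rw [← hv]
    congr 1
    push_cast
    field_simp
    ring
  let F : ℤ → ℝ := fun j => H (j + R) - H (j - R)
  have hF : ∀ j, F (j + s) = F j := by
    intro j
    simp only [F]
    rw [show j + s + R = (j + R) + s by ring, show j + s - R = (j - R) + s by ring, hH, hH]
    ring
  have h1 := sum_perm_aux s hs p hp F hF
  have h2 : ∑ i ∈ range s, (v (y + i * (p / s : ℝ) + R / s) - v (y + i * (p / s : ℝ) - R / s))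
      = ∑ i ∈ range s, F ((i : ℤ) * p) := by
    refine sum_congr rfl fun i _ => ?_
    simp only [F, H]
    push_cast
    congr 2 <;> field_simp <;> ring
  rw [h2, h1]
  let A : ℤ → ℝ := fun m => ∑ j ∈ range s, H (j + m)
  have hA : ∀ m, A (m + 1) = A m + V := by
    intro m
    have e1 := Finset.sum_range_succ (fun j : ℕ => H (j + m)) s
    have e2 := Finset.sum_range_succ' (fun j : ℕ => H (j + m)) s
    have e3 : H ((s : ℕ) + m) = H m + V := by rw [add_comm]; exact hH m
    simp only [A]
    have e4 : ∑ j ∈ range s, H ((j : ℤ) + (m + 1)) = ∑ j ∈ range s, H (((j + 1 : ℕ) : ℤ) + m) := by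
      refine sum_congr rfl fun i _ => ?_
      congr 1; push_cast; ring
    rw [e4]
    simp only [Nat.cast_zero, zero_add] at e2
    linarith
  have hA2 : ∀ n : ℕ, ∀ m, A (m + n) = A m + n * V := by
    intro n
    induction n with
    | zero => intro m; simp
    | succ n ih =>
      intro m
      rw [Nat.cast_succ, ← add_assoc, hA, ih]; push_cast; ring
  have h3 := hA2 (2 * R) (-R)
  have h4 : ∑ j ∈ range s, F (j : ℤ) = A R - A (-R) := by
    simp only [F, A, sub_eq_add_neg, sum_add_distrib, sum_neg_distrib]
  rw [h4]
  rw [show (-(R : ℤ)) + ((2 * R : ℕ) : ℤ) = R by push_cast; ring] at h3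
  rw [h3]; push_cast; ring

lemma QPv.mono {v V g} (h : QPv v V g) : Monotone v := fun u w huw => by
  have := h.2 u w huw
  have := abs_nonneg (g (u : UnitAddCircle) - g (w : UnitAddCircle))
  linarith

lemma QPv.abs_le {v V g} (h : QPv v V g) {a b u w : ℝ} (h1 : a ≤ u) (h2 : u ≤ b) (h3 : a ≤ w)
    (h4 : w ≤ b) : |g (u : UnitAddCircle) - g (w : UnitAddCircle)| ≤ v b - v a := by
  rcases le_total u w with h5 | h5
  · have := h.2 u w h5
    have := h.mono h1
    have := h.mono h4
    linarith
  · have := h.2 w u h5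
    rw [abs_sub_comm]
    have := h.mono h3
    have := h.mono h2
    linarith

lemma app_err {β : ℝ} {p : ℤ} {s : ℕ} (h : GoodApp β p s) {i : ℕ} (hi : i ≤ s) :
    |i * β - i * (p / s : ℝ)| ≤ 1 / s := by
  obtain ⟨hs, -, hb⟩ := h
  have hs' : (0 : ℝ) < s := by exact_mod_cast hs
  have hi' : (i : ℝ) ≤ s := by exact_mod_cast hi
  rw [← mul_sub, abs_mul, abs_of_nonneg (by positivity : (0 : ℝ) ≤ i)]
  calc (i : ℝ) * |β - p / s| ≤ s * (1 / s ^ 2) := by gcongr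
    _ = 1 / s := by field_simp

lemma lift_close (z z' : UnitAddCircle) (r : ℝ) (h : ‖z' - z‖ ≤ r) :
    ∃ t t' : ℝ, z = (t : UnitAddCircle) ∧ z' = (t' : UnitAddCircle) ∧ |t' - t| ≤ r := by
  obtain ⟨t, rfl⟩ := QuotientAddGroup.mk_surjective z
  obtain ⟨t', rfl⟩ := QuotientAddGroup.mk_surjective z'
  change ‖((t' : ℝ) : UnitAddCircle) - ((t : ℝ) : UnitAddCircle)‖ ≤ r at h
  rw [← AddCircle.coe_sub, UnitAddCircle.norm_eq] at h
  refine ⟨t, t' - round (t' - t), rfl, ?_, ?_⟩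
  · have : (((round (t' - t) : ℤ) : ℝ) : UnitAddCircle) = 0 := by
      have := (AddCircle.coe_eq_zero_iff (1 : ℝ) (x := ((round (t' - t) : ℤ) : ℝ))).2
        ⟨round (t' - t), by simp⟩
      exact this
    change ((t' : ℝ) : UnitAddCircle) = _
    rw [AddCircle.coe_sub, this, sub_zero]
  · convert h using 2; ring

/-- Birkhoff sums. -/
def Bsum (g : UnitAddCircle → ℝ) (b : UnitAddCircle) (j : ℕ) (z : UnitAddCircle) : ℝ :=
  ∑ i ∈ range j, g (z + i • b)

lemma Bsum_zero (g b z) : Bsum g b 0 z = 0 := by simp [Bsum]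

lemma Bsum_add (g b z) (m n : ℕ) : Bsum g b (m + n) z = Bsum g b m z + Bsum g b n (z + m • b) := by
  simp only [Bsum, sum_range_add, add_smul, add_assoc]

lemma Bsum_succ (g b z) (n : ℕ) : Bsum g b (n + 1) z = Bsum g b n z + g (z + n • b) := by
  simp only [Bsum, sum_range_succ]

lemma distortion {β : ℝ} {p : ℤ} {s : ℕ} (h : GoodApp β p s) {v V g} (hg : QPv v V g) (R : ℕ)
    {z z' : UnitAddCircle} (hz : ‖z' - z‖ ≤ R / s) {j : ℕ} (hj : j ≤ s) :
    |Bsum g (β : UnitAddCircle) j z - Bsum g (β : UnitAddCircle) j z'| ≤ 2 * (R + 1) * V := by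
  obtain ⟨t, t', rfl, rfl, htt⟩ := lift_close z z' _ hz
  have hs' : (0 : ℝ) < s := by exact_mod_cast h.1
  have key : ∀ i ∈ range s, |g ((t : UnitAddCircle) + i • (β : UnitAddCircle)) -
      g ((t' : UnitAddCircle) + i • (β : UnitAddCircle))| ≤
      v (t + i * (p / s : ℝ) + (R + 1 : ℕ) / s) - v (t + i * (p / s : ℝ) - (R + 1 : ℕ) / s) := by
    intro i hi
    have e := app_err h (mem_range.mp hi).le
    rw [abs_le] at e htt
    have e1 : ∀ u : ℝ, (u : UnitAddCircle) + i • (β : UnitAddCircle) = ((u + i * β : ℝ) : UnitAddCircle) := by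
      intro u
      rw [AddCircle.coe_add, ← nsmul_eq_mul, AddCircle.coe_nsmul]
    rw [e1, e1]
    have hR : (0 : ℝ) ≤ R / s := by positivity
    have h1s : (0 : ℝ) ≤ 1 / s := by positivity
    have e2 : ((R + 1 : ℕ) : ℝ) / s = R / s + 1 / s := by push_cast; ring
    rw [e2]
    apply hg.abs_le <;> linarith [htt.1, htt.2, e.1, e.2]
  calc |Bsum g (β : UnitAddCircle) j t - Bsum g (β : UnitAddCircle) j t'|
      ≤ ∑ i ∈ range j, |g ((t : UnitAddCircle) + i • (β : UnitAddCircle)) -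
      g ((t' : UnitAddCircle) + i • (β : UnitAddCircle))| := by
        simp only [Bsum, ← sum_sub_distrib]
        exact abs_sum_le_sum_abs _ _
    _ ≤ ∑ i ∈ range s, |g ((t : UnitAddCircle) + i • (β : UnitAddCircle)) -
      g ((t' : UnitAddCircle) + i • (β : UnitAddCircle))| := by
        apply sum_le_sum_of_subset_of_nonneg (range_mono hj)
        intros; positivity
    _ ≤ _ := sum_le_sum key
    _ = _ := by
        rw [tele_aux s h.1 p h.2.1 v V hg.1]; push_cast; ring

lemma floor_aux (t : ℝ) : ((⌊t + 1⌋ : ℤ) : ℝ) = (⌊t⌋ : ℝ) + 1 := by simp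

lemma lift_pt (z : UnitAddCircle) (t β : ℝ) (hz : z = (t : UnitAddCircle)) (i : ℕ) :
    z + i • (β : UnitAddCircle) = ((t + i * β : ℝ) : UnitAddCircle) := by
  rw [hz, AddCircle.coe_add, ← nsmul_eq_mul, AddCircle.coe_nsmul]

/-- covering -/
lemma covering {β : ℝ} {p : ℤ} {s : ℕ} (h : GoodApp β p s) (z : UnitAddCircle) :
    ∃ j < s, ‖z + j • (β : UnitAddCircle)‖ ≤ (2 : ℕ) / s := by
  obtain ⟨t, hz⟩ := QuotientAddGroup.mk_surjective z
  have ht := tele_aux s h.1 p h.2.1 (fun t => (⌊t⌋ : ℝ)) 1 floor_aux 1 t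
  have : ∃ i ∈ range s, (0 : ℝ) < (⌊t + i * (p / s : ℝ) + (1 : ℕ) / s⌋ : ℝ) -
      (⌊t + i * (p / s : ℝ) - (1 : ℕ) / s⌋ : ℝ) := by
    apply exists_lt_of_sum_lt
    rw [ht]; simp
  obtain ⟨i, hi, hlt⟩ := this
  refine ⟨i, mem_range.mp hi, ?_⟩
  rw [lift_pt z t β hz.symm, UnitAddCircle.norm_eq]
  refine (round_le (t + i * β) ⌊t + i * (p / s : ℝ) + (1 : ℕ) / s⌋).trans ?_
  have e := app_err h (mem_range.mp hi).le
  have h1 : ⌊t + i * (p / s : ℝ) - (1 : ℕ) / s⌋ < ⌊t + i * (p / s : ℝ) + (1 : ℕ) / s⌋ := by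
    exact_mod_cast sub_pos.mp hlt
  have h2 := Int.floor_lt.mp h1
  have h3 := Int.floor_le (t + i * (p / s : ℝ) + (1 : ℕ) / s)
  have h4 : ((2 : ℕ) : ℝ) / s = 1 / s + 1 / s := by push_cast; ring
  rw [h4]
  push_cast at h2 h3 ⊢
  rw [abs_le] at e ⊢
  constructor <;> linarith [e.1, e.2]

/-- bounded multiplicity -/
lemma mult_bound {β : ℝ} {p : ℤ} {s : ℕ} (h : GoodApp β p s) (z : UnitAddCircle) (R : ℕ) :
    (((range s).filter (fun j : ℕ => ‖z + j • (β : UnitAddCircle)‖ < R / s)).card : ℝ)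
      ≤ 2 * (R + 1) := by
  obtain ⟨t, hz⟩ := QuotientAddGroup.mk_surjective z
  have ht := tele_aux s h.1 p h.2.1 (fun t => (⌊t⌋ : ℝ)) 1 floor_aux (R + 1) t
  have hs' : (0 : ℝ) < s := by exact_mod_cast h.1
  have h1s : (0 : ℝ) ≤ 1 / s := by positivity
  have hR : (0 : ℝ) ≤ R / s := by positivity
  have e2 : ((R + 1 : ℕ) : ℝ) / s = R / s + 1 / s := by push_cast; ring
  calc (((range s).filter (fun j : ℕ => ‖z + j • (β : UnitAddCircle)‖ < R / s)).card : ℝ)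
      = ∑ i ∈ range s, if ‖z + i • (β : UnitAddCircle)‖ < R / s then (1 : ℝ) else 0 := by
        rw [Finset.sum_boole]
    _ ≤ ∑ i ∈ range s, ((⌊t + i * (p / s : ℝ) + (R + 1 : ℕ) / s⌋ : ℝ) -
      (⌊t + i * (p / s : ℝ) - (R + 1 : ℕ) / s⌋ : ℝ)) := by
        refine sum_le_sum fun i hi => ?_
        have e := app_err h (mem_range.mp hi).le
        rw [abs_le] at e
        split_ifs with hlt
        · rw [lift_pt z t β hz.symm, UnitAddCircle.norm_eq, abs_lt] at hlt
          rw [e2]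
          have a1 : round (t + i * β) ≤ ⌊t + i * (p / s : ℝ) + (R / s + 1 / s)⌋ := by
            rw [Int.le_floor]; linarith [hlt.1, e.2]
          have a2 : ⌊t + i * (p / s : ℝ) - (R / s + 1 / s)⌋ < round (t + i * β) := by
            rw [Int.floor_lt]; linarith [hlt.2, e.1]
          have a3 : ⌊t + i * (p / s : ℝ) - (R / s + 1 / s)⌋ + 1 ≤ ⌊t + i * (p / s : ℝ) + (R / s + 1 / s)⌋ := by
            omega
          have : ((⌊t + i * (p / s : ℝ) - (R / s + 1 / s)⌋ + 1 : ℤ) : ℝ) ≤ ⌊t + i * (p / s : ℝ) + (R / s + 1 / s)⌋ := by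
            exact_mod_cast a3
          push_cast at this
          linarith
        · rw [sub_nonneg, Int.cast_le]
          apply Int.floor_le_floor
          rw [e2]; linarith
    _ = _ := by rw [ht]; push_cast; ring

lemma good_inf {β : ℝ} (hβ : Irrational β) : {s : ℕ | ∃ p : ℤ, GoodApp β p s}.Infinite := by
  have h := Real.infinite_rat_abs_sub_lt_one_div_den_sq_of_irrational hβ
  intro hfin
  apply h
  obtain ⟨N, hN⟩ := hfin.bddAbove
  have hsub : {q : ℚ | |β - q| < 1 / (q.den : ℝ) ^ 2} ⊆
      (fun x : ℤ × ℕ => (x.1 : ℚ) / (x.2 : ℚ)) ''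
        ((Set.Icc (-⌈(|β| + 1) * N⌉) ⌈(|β| + 1) * N⌉ ×ˢ Set.Icc 0 N : Set (ℤ × ℕ))) := by
    intro q hq
    have hq' : |β - q| < 1 / (q.den : ℝ) ^ 2 := hq
    have hd : (0 : ℝ) < q.den := by exact_mod_cast q.den_pos
    have hqe : (q : ℝ) = (q.num : ℝ) / (q.den : ℝ) := by exact_mod_cast (Rat.num_div_den q).symm
    have hden : q.den ≤ N := by
      apply hN
      refine ⟨q.num, q.den_pos, ?_, ?_⟩
      · rw [Int.isCoprime_iff_gcd_eq_one]
        exact q.reduced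
      · rw [← hqe]; exact hq'
    have hd1 : (1 : ℝ) ≤ q.den := by exact_mod_cast q.den_pos
    have h1 : 1 / (q.den : ℝ) ^ 2 ≤ 1 := by
      rw [div_le_one (by positivity)]; nlinarith
    have h2 : |(q : ℝ)| ≤ |β| + 1 := by
      have := abs_sub_abs_le_abs_sub (q : ℝ) β
      rw [abs_sub_comm] at this
      linarith
    have h3 : |(q.num : ℝ)| ≤ (|β| + 1) * N := by
      have : (q.num : ℝ) = q * q.den := by rw [hqe]; field_simp
      rw [this, abs_mul, abs_of_pos hd]
      have : (q.den : ℝ) ≤ N := by exact_mod_cast hden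
      gcongr
    have h4 := h3.trans (Int.le_ceil _)
    rw [abs_le] at h4
    refine ⟨(q.num, q.den), ⟨⟨by exact_mod_cast h4.1, by exact_mod_cast h4.2⟩,
      ⟨Nat.zero_le _, hden⟩⟩, ?_⟩
    exact Rat.num_div_den q
  refine Set.Finite.subset ?_ hsub
  exact ((Set.finite_Icc _ _).prod (Set.finite_Icc _ _)).image _

lemma Bsum_cont {g : UnitAddCircle → ℝ} (hc : Continuous g) (b : UnitAddCircle) (j : ℕ) :
    Continuous (Bsum g b j) := by
  unfold Bsum; fun_prop

lemma int_of_cont {g : UnitAddCircle → ℝ} (hc : Continuous g) : Integrable g := by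
  exact hc.integrable_of_hasCompactSupport (HasCompactSupport.of_compactSpace g)

lemma Bsum_int {g : UnitAddCircle → ℝ} (hc : Continuous g) (h0 : ∫ z, g z = 0) (b : UnitAddCircle)
    (j : ℕ) : ∫ z, Bsum g b j z = 0 := by
  unfold Bsum
  rw [integral_finsetSum _ (fun i _ => int_of_cont (by fun_prop))]
  apply Finset.sum_eq_zero
  intro i _
  rw [integral_add_right_eq_self (μ := (volume : Measure UnitAddCircle)) g (i • b), h0]

lemma exists_nonpos {G : UnitAddCircle → ℝ} (hc : Continuous G) (h0 : ∫ z, G z = 0) :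
    ∃ z, G z ≤ 0 := by
  by_contra! hcon
  have := hc.integral_pos_of_hasCompactSupport_nonneg_nonzero (μ := (volume : Measure UnitAddCircle))
    (HasCompactSupport.of_compactSpace G) (fun z => (hcon z).le) (hcon 0).ne'
  linarith

lemma norm_smul_good {β : ℝ} {p : ℤ} {s : ℕ} (h : GoodApp β p s) :
    ‖s • (β : UnitAddCircle)‖ ≤ (1 : ℕ) / s := by
  have e := app_err h le_rfl
  have := lift_pt 0 0 β (by simp) s
  simp only [zero_add] at this
  rw [this, UnitAddCircle.norm_eq]
  refine (round_le _ p).trans ?_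
  have hs' : (s : ℝ) ≠ 0 := by exact_mod_cast h.1.ne'
  rw [show (s : ℝ) * (p / s) = p by field_simp] at e
  simpa using e

lemma DK {β : ℝ} {v V g} (hg : QPv v V g) (hc : Continuous g) (h0 : ∫ z, g z = 0) {p : ℤ} {s : ℕ}
    (h : GoodApp β p s) (z : UnitAddCircle) : |Bsum g (β : UnitAddCircle) s z| ≤ 10 * V := by
  have step : ∀ y0 z : UnitAddCircle, |Bsum g (β : UnitAddCircle) s z - Bsum g (β : UnitAddCircle) s y0| ≤ 10 * V := by
    intro y0 z
    obtain ⟨j, hj, hn⟩ := covering h (y0 - z)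
    have h1 := distortion h hg 2 (z := z) (z' := y0 + j • (β : UnitAddCircle)) (j := s)
      (by convert hn using 2; abel) le_rfl
    have h2 := distortion h hg 1 (z := y0) (z' := y0 + s • (β : UnitAddCircle)) (j := j)
      (by simpa using norm_smul_good h) hj.le
    have e1 := Bsum_add g (β : UnitAddCircle) y0 j s
    have e2 := Bsum_add g (β : UnitAddCircle) y0 s j
    rw [add_comm] at e1
    push_cast at h1 h2
    rw [abs_le] at h1 h2 ⊢
    constructor <;> linarith [h1.1, h1.2, h2.1, h2.2]
  obtain ⟨y0, hy0⟩ := exists_nonpos (Bsum_cont hc (β : UnitAddCircle) s) (Bsum_int hc h0 _ s)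
  obtain ⟨y1, hy1⟩ := exists_nonpos (Bsum_cont hc (β : UnitAddCircle) s).neg
    (by rw [integral_neg', Bsum_int hc h0 _ s, neg_zero])
  have s0 := step y0 z
  have s1 := step y1 z
  simp only [Pi.neg_apply] at hy1
  rw [abs_le] at s0 s1 ⊢
  constructor <;> linarith [s0.1, s0.2, s1.1, s1.2]

lemma growth {β : ℝ} (hβ : Irrational β) {v V g} (hg : QPv v V g) (hc : Continuous g)
    (h0 : ∫ z, g z = 0) (N : ℝ) : ∃ J0 : ℕ, ∀ J ≥ J0, ∀ z : UnitAddCircle,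
      N ≤ ∑ j ∈ range J, Real.exp (Bsum g β j z) ∧
      N * Real.exp (Bsum g β J z) ≤ ∑ j ∈ range J, Real.exp (Bsum g β j z) := by
  obtain ⟨n, hn⟩ := exists_nat_ge (N * Real.exp (10 * V))
  obtain ⟨T, hT, hTc⟩ := (good_inf hβ).exists_subset_card_eq n
  have hN : N ≤ n * Real.exp (-(10 * V)) := by
    rw [Real.exp_neg, ← div_eq_mul_inv, le_div_iff₀ (Real.exp_pos _)]; exact hn
  refine ⟨T.sup id + 1, fun J hJ z => ?_⟩
  have hTJ : ∀ s ∈ T, s < J := fun s hs => by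
    have := Finset.le_sup (f := id) hs
    simp only [id] at this
    omega
  have hTdk : ∀ s ∈ T, ∀ z, |Bsum g β s z| ≤ 10 * V := fun s hs z => by
    obtain ⟨p, hp⟩ := hT hs
    exact DK hg hc h0 hp z
  have hTpos : ∀ s ∈ T, 0 < s := fun s hs => by
    obtain ⟨p, hp⟩ := hT hs
    exact hp.1
  constructor
  · calc N ≤ n * Real.exp (-(10 * V)) := hN
      _ = ∑ s ∈ T, Real.exp (-(10 * V)) := by rw [sum_const, hTc, nsmul_eq_mul]
      _ ≤ ∑ s ∈ T, Real.exp (Bsum g β s z) := by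
        refine sum_le_sum fun s hs => Real.exp_le_exp.2 (abs_le.mp (hTdk s hs z)).1
      _ ≤ _ := by
        apply sum_le_sum_of_subset_of_nonneg
        · intro s hs; exact mem_range.2 (hTJ s hs)
        · intros; positivity
  · have hinj : Set.InjOn (fun s => J - s) (T : Set ℕ) := by
      intro a ha b hb hab
      have := hTJ a ha
      have := hTJ b hb
      simp only at hab
      omega
    calc N * Real.exp (Bsum g β J z) ≤ n * Real.exp (-(10 * V)) * Real.exp (Bsum g β J z) := by
          gcongr
      _ = ∑ s ∈ T, Real.exp (-(10 * V)) * Real.exp (Bsum g β J z) := by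
          rw [sum_const, hTc, nsmul_eq_mul]; ring
      _ ≤ ∑ s ∈ T, Real.exp (Bsum g β (J - s) z) := by
        refine sum_le_sum fun s hs => ?_
        rw [← Real.exp_add]
        apply Real.exp_le_exp.2
        have e := Bsum_add g (β : UnitAddCircle) z (J - s) s
        rw [Nat.sub_add_cancel (hTJ s hs).le] at e
        have := (abs_le.mp (hTdk s hs (z + (J - s) • (β : UnitAddCircle)))).2
        linarith
      _ = ∑ j ∈ T.image (fun s => J - s), Real.exp (Bsum g β j z) := by
        rw [sum_image hinj]
      _ ≤ _ := by
        apply sum_le_sum_of_subset_of_nonneg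
        · intro j hj
          obtain ⟨s, hs, rfl⟩ := mem_image.mp hj
          have := hTJ s hs
          have := hTpos s hs
          exact mem_range.2 (by omega)
        · intros; positivity

lemma exists_QPv (f : UnitAddCircle → ℝ)
    (hf : BoundedVariationOn (fun t : ℝ => f (t : UnitAddCircle)) (Set.Icc 0 1)) :
    ∃ v V, QPv v V f := by
  set F : ℝ → ℝ := fun t : ℝ => f (t : UnitAddCircle) with hF
  let W : ℝ → ℝ := fun u => (eVariationOn F (Set.Icc 0 u)).toReal
  have hfin : ∀ u ≤ (1 : ℝ), eVariationOn F (Set.Icc 0 u) ≠ ⊤ := fun u hu =>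
    ne_top_of_le_ne_top hf (eVariationOn.mono F (Set.Icc_subset_Icc_right hu))
  have hinc : ∀ a b : ℝ, 0 ≤ a → a ≤ b → b ≤ 1 → |F a - F b| ≤ W b - W a := by
    intro a b ha hab hb
    have h1 := eVariationOn.Icc_add_Icc F (s := Set.univ) ha hab (Set.mem_univ a)
    simp only [Set.univ_inter] at h1
    have hfin2 : eVariationOn F (Set.Icc a b) ≠ ⊤ :=
      ne_top_of_le_ne_top hf (eVariationOn.mono F (Set.Icc_subset_Icc ha hb))
    have h2 : edist (F a) (F b) ≤ eVariationOn F (Set.Icc a b) :=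
      eVariationOn.edist_le F ⟨le_rfl, hab⟩ ⟨hab, le_rfl⟩
    have h3 : W b = W a + (eVariationOn F (Set.Icc a b)).toReal := by
      simp only [W]
      rw [← h1, ENNReal.toReal_add (hfin a (hab.trans hb)) hfin2]
    have h4 := ENNReal.toReal_mono hfin2 h2
    rw [edist_dist, ENNReal.toReal_ofReal dist_nonneg, Real.dist_eq] at h4
    linarith
  have hW0 : W 0 = 0 := by
    simp only [W, Set.Icc_self]
    rw [eVariationOn.subsingleton F Set.subsingleton_singleton]; rfl
  have hper : ∀ t : ℝ, F t = F (Int.fract t) := by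
    intro t
    simp only [hF]
    congr 1
    rw [Int.fract, AddCircle.coe_sub]
    have : (((⌊t⌋ : ℤ) : ℝ) : UnitAddCircle) = 0 :=
      (AddCircle.coe_eq_zero_iff (1 : ℝ)).2 ⟨⌊t⌋, by simp⟩
    rw [this, sub_zero]
  have h01 : F 1 = F 0 := by
    rw [hper 1]; simp
  refine ⟨fun t => ⌊t⌋ * W 1 + W (Int.fract t), W 1, fun t => ?_, fun u w huw => ?_⟩
  · simp only [Int.floor_add_one, Int.fract_add_one]; push_cast; ring
  · change |F u - F w| ≤ _
    have hle := Int.floor_le_floor huw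
    have fu := Int.fract_nonneg u
    have fu1 := (Int.fract_lt_one u).le
    have fw := Int.fract_nonneg w
    have fw1 := (Int.fract_lt_one w).le
    rw [hper u, hper w]
    rcases hle.eq_or_lt with he | hlt
    · have : Int.fract u ≤ Int.fract w := by
        unfold Int.fract; rw [he]; linarith
      have := hinc _ _ fu this fw1
      simp only [he]
      linarith
    · have a1 := hinc _ _ fu fu1 le_rfl
      have a2 := hinc _ _ le_rfl fw fw1
      have a3 := hinc 0 1 le_rfl zero_le_one le_rfl
      have a4 := abs_nonneg (F 0 - F 1)
      rw [hW0] at a2 a3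
      rw [h01] at a1
      have a5 := abs_sub_le (F (Int.fract u)) (F 0) (F (Int.fract w))
      have hlt' : (⌊u⌋ : ℝ) + 1 ≤ ⌊w⌋ := by exact_mod_cast hlt
      have : 0 ≤ W 1 := by linarith
      nlinarith

lemma QPv_double {f : UnitAddCircle → ℝ} {v V} (h : QPv v V f) (α : ℝ) :
    QPv (fun t => v t + v (t + α)) (2 * V) (fun z => f z + f (z + (α : UnitAddCircle))) := by
  refine ⟨fun t => ?_, fun u w huw => ?_⟩
  · simp only
    rw [show t + 1 + α = (t + α) + 1 by ring, h.1, h.1]; ring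
  · have h1 := h.2 u w huw
    have h2 := h.2 (u + α) (w + α) (by linarith)
    simp only [AddCircle.coe_add] at h2
    rw [abs_le] at *
    constructor <;> linarith [h1.1, h1.2, h2.1, h2.2]

def PosF (Λ : C(UnitAddCircle, ℝ) →ₗ[ℝ] ℝ) : Prop :=
  ∀ φ : C(UnitAddCircle, ℝ), (∀ z, 0 ≤ φ z) → 0 ≤ Λ φ

def ConfF (g : UnitAddCircle → ℝ) (b : UnitAddCircle) (Λ : C(UnitAddCircle, ℝ) →ₗ[ℝ] ℝ) : Prop :=
  ∀ φ ψ : C(UnitAddCircle, ℝ), (∀ z, ψ z = φ (z + b) * Real.exp (g z)) → Λ ψ = Λ φ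

lemma PosF.mono {Λ} (h : PosF Λ) {φ ψ : C(UnitAddCircle, ℝ)} (hle : ∀ z, φ z ≤ ψ z) :
    Λ φ ≤ Λ ψ := by
  have := h (ψ - φ) (fun z => by simpa using hle z)
  rw [map_sub] at this
  linarith

lemma ConfF.iter {g : UnitAddCircle → ℝ} (hc : Continuous g) {b Λ} (h : ConfF g b Λ) (j : ℕ) :
    ∀ φ ψ : C(UnitAddCircle, ℝ), (∀ z, ψ z = φ (z + j • b) * Real.exp (Bsum g b j z)) →
      Λ ψ = Λ φ := by
  induction j with
  | zero =>
    intro φ ψ hψ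
    congr 1
    ext z
    simp [hψ, Bsum_zero]
  | succ j ih =>
    intro φ ψ hψ
    have hB := Bsum_cont hc b j
    let χ : C(UnitAddCircle, ℝ) := ⟨fun z => φ (z + j • b) * Real.exp (Bsum g b j z), by fun_prop⟩
    rw [← ih φ χ (fun z => rfl)]
    apply h
    intro z
    rw [hψ]
    simp only [χ, ContinuousMap.coe_mk]
    rw [add_comm j 1, Bsum_add, Real.exp_add]
    have : Bsum g b 1 z = g z := by simp [Bsum]
    rw [this, add_smul, one_smul, ← add_assoc]
    ring

def tent (s : ℕ) (b : UnitAddCircle) (j : ℕ) : C(UnitAddCircle, ℝ) :=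
  ⟨fun z => max 0 (1 - s * ‖z + j • b‖ / 4), by fun_prop⟩

lemma tent_nonneg (s b j z) : 0 ≤ tent s b j z := le_max_left _ _

lemma tent_le_one (s b j z) : tent s b j z ≤ 1 := by
  simp only [tent, ContinuousMap.coe_mk]
  apply max_le (by norm_num)
  have : (0 : ℝ) ≤ s * ‖z + j • b‖ / 4 := by positivity
  linarith

lemma tent_supp {s : ℕ} (hs : 0 < s) {b j z} (h : ¬ ‖z + j • b‖ < (4 : ℕ) / s) :
    tent s b j z = 0 := by
  have hs' : (0 : ℝ) < s := by exact_mod_cast hs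
  simp only [tent, ContinuousMap.coe_mk]
  apply max_eq_left
  rw [not_lt, div_le_iff₀ hs'] at h
  push_cast at h
  linarith

lemma tent_half {s : ℕ} (hs : 0 < s) {b j z} (h : ‖z + j • b‖ ≤ (2 : ℕ) / s) :
    1 / 2 ≤ tent s b j z := by
  have hs' : (0 : ℝ) < s := by exact_mod_cast hs
  simp only [tent, ContinuousMap.coe_mk]
  apply le_max_of_le_right
  rw [le_div_iff₀ hs'] at h
  push_cast at h
  linarith

lemma tent_sum_le {β : ℝ} {p : ℤ} {s : ℕ} (h : GoodApp β p s) (z : UnitAddCircle) :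
    ∑ j ∈ range s, tent s β j z ≤ 10 := by
  have hm := mult_bound h z 4
  calc ∑ j ∈ range s, tent s β j z
      ≤ ∑ j ∈ range s, if ‖z + j • (β : UnitAddCircle)‖ < (4 : ℕ) / s then (1 : ℝ) else 0 := by
        refine sum_le_sum fun j _ => ?_
        split_ifs with hlt
        · exact tent_le_one _ _ _ _
        · exact (tent_supp h.1 hlt).le
    _ ≤ 10 := by
        rw [Finset.sum_boole]
        refine hm.trans (by norm_num)

lemma tent_sum_ge {β : ℝ} {p : ℤ} {s : ℕ} (h : GoodApp β p s) (z : UnitAddCircle) :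
    1 / 2 ≤ ∑ j ∈ range s, tent s β j z := by
  obtain ⟨j, hj, hn⟩ := covering h z
  exact (tent_half h.1 hn).trans
    (single_le_sum (f := fun j => tent s β j z) (fun i _ => tent_nonneg _ _ _ _) (mem_range.2 hj))

lemma tent_cmp {β : ℝ} {p : ℤ} {s : ℕ} (h : GoodApp β p s) {v V g} (hg : QPv v V g)
    (hc : Continuous g) {Λ} (hP : PosF Λ) (hC : ConfF g β Λ) {j : ℕ} (hj : j < s) :
    Λ (tent s β j) ≤
      Real.exp (10 * V) * (Real.exp (-Bsum g β j (-(j • (β : UnitAddCircle)))) * Λ (tent s β 0)) ∧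
    Real.exp (-Bsum g β j (-(j • (β : UnitAddCircle)))) * Λ (tent s β 0) ≤
      Real.exp (10 * V) * Λ (tent s β j) := by
  have hB := Bsum_cont hc (β : UnitAddCircle) j
  let ψ : C(UnitAddCircle, ℝ) := ⟨fun z => tent s β 0 (z + j • (β : UnitAddCircle)) *
    Real.exp (Bsum g β j z), by fun_prop⟩
  have e1 : Λ ψ = Λ (tent s β 0) := hC.iter hc j _ _ (fun z => rfl)
  have e2 : ∀ z, ψ z = tent s β j z * Real.exp (Bsum g β j z) := by
    intro z
    simp [ψ, tent]
  set c := Bsum g β j (-(j • (β : UnitAddCircle))) with hcdef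
  have hd : ∀ z, ‖z + j • (β : UnitAddCircle)‖ < (4 : ℕ) / s → |c - Bsum g β j z| ≤ 10 * V := by
    intro z hz
    have := distortion h hg 4 (z := -(j • (β : UnitAddCircle))) (z' := z) (j := j)
      (by rw [sub_neg_eq_add]; exact hz.le) hj.le
    refine this.trans (by push_cast; linarith)
  rw [← e1]
  constructor
  · have : Λ (tent s β j) ≤ Λ ((Real.exp (10 * V) * Real.exp (-c)) • ψ) := by
      apply hP.mono
      intro z
      rw [ContinuousMap.smul_apply, e2, smul_eq_mul]
      by_cases hz : ‖z + j • (β : UnitAddCircle)‖ < (4 : ℕ) / s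
      · have := abs_le.mp (hd z hz)
        have h1 : 1 ≤ Real.exp (10 * V) * Real.exp (-c) * Real.exp (Bsum g β j z) := by
          rw [← Real.exp_add, ← Real.exp_add]
          apply Real.one_le_exp
          linarith [this.2]
        nlinarith [tent_nonneg s (β : UnitAddCircle) j z]
      · rw [tent_supp h.1 hz]; simp
    rw [map_smul, smul_eq_mul, mul_assoc] at this
    exact this
  · have : Λ (Real.exp (-c) • ψ) ≤ Λ (Real.exp (10 * V) • tent s β j) := by
      apply hP.mono
      intro z
      rw [ContinuousMap.smul_apply, e2, smul_eq_mul, ContinuousMap.smul_apply, smul_eq_mul]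
      by_cases hz : ‖z + j • (β : UnitAddCircle)‖ < (4 : ℕ) / s
      · have := abs_le.mp (hd z hz)
        have h1 : Real.exp (-c) * Real.exp (Bsum g β j z) ≤ Real.exp (10 * V) := by
          rw [← Real.exp_add]
          apply Real.exp_le_exp.2
          linarith [this.1]
        nlinarith [tent_nonneg s (β : UnitAddCircle) j z]
      · rw [tent_supp h.1 hz]; simp
    rw [map_smul, smul_eq_mul, map_smul, smul_eq_mul] at this
    exact this

lemma tent_cmp2 {β : ℝ} {p : ℤ} {s : ℕ} (h : GoodApp β p s) {v V g} (hg : QPv v V g)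
    (hc : Continuous g) {Λ Λ'} (hP : PosF Λ) (hC : ConfF g β Λ) (hP' : PosF Λ') (hC' : ConfF g β Λ')
    {j : ℕ} (hj : j < s) :
    Λ' (tent s β j) * Λ 1 ≤ 20 * Real.exp (10 * V) ^ 4 * (Λ (tent s β j) * Λ' 1) := by
  set K := Real.exp (10 * V) with hK
  have hKpos : 0 < K := Real.exp_pos _
  let bb : ℕ → ℝ := fun j => Real.exp (-Bsum g β j (-(j • (β : UnitAddCircle))))
  have hbb : ∀ j, 0 < bb j := fun j => Real.exp_pos _
  set Z := ∑ j ∈ range s, bb j with hZ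
  have hZpos : 0 < Z := sum_pos (fun j _ => hbb j) ⟨0, mem_range.2 h.1⟩
  have u : ∀ i < s, Λ (tent s β i) ≤ K * (bb i * Λ (tent s β 0)) ∧
     bb i * Λ (tent s β 0) ≤ K * Λ (tent s β i) := fun i hi => tent_cmp h hg hc hP hC hi
  have u' : ∀ i < s, Λ' (tent s β i) ≤ K * (bb i * Λ' (tent s β 0)) ∧
     bb i * Λ' (tent s β 0) ≤ K * Λ' (tent s β i) := fun i hi => tent_cmp h hg hc hP' hC' hi
  have a1 : 1 / 2 * Λ 1 ≤ K * (Z * Λ (tent s β 0)) := by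
    calc 1 / 2 * Λ 1 = Λ ((1 / 2 : ℝ) • 1) := by rw [map_smul, smul_eq_mul]
      _ ≤ Λ (∑ j ∈ range s, tent s β j) := by
        apply hP.mono
        intro z
        simpa using tent_sum_ge h z
      _ = ∑ j ∈ range s, Λ (tent s β j) := map_sum _ _ _
      _ ≤ ∑ j ∈ range s, K * (bb j * Λ (tent s β 0)) :=
        sum_le_sum fun i hi => (u i (mem_range.1 hi)).1
      _ = _ := by rw [← mul_sum, ← sum_mul]
  have a2 : Z * Λ' (tent s β 0) ≤ K * (10 * Λ' 1) := by
    calc Z * Λ' (tent s β 0) = ∑ j ∈ range s, bb j * Λ' (tent s β 0) := by rw [sum_mul]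
      _ ≤ ∑ j ∈ range s, K * Λ' (tent s β j) :=
        sum_le_sum fun i hi => (u' i (mem_range.1 hi)).2
      _ = K * Λ' (∑ j ∈ range s, tent s β j) := by rw [← mul_sum, map_sum]
      _ ≤ K * Λ' ((10 : ℝ) • 1) := by
        apply mul_le_mul_of_nonneg_left _ hKpos.le
        apply hP'.mono
        intro z
        simpa using tent_sum_le h z
      _ = _ := by rw [map_smul, smul_eq_mul]
  have t0 : 0 ≤ Λ (tent s β 0) := hP _ (tent_nonneg _ _ _)
  have t0' : 0 ≤ Λ' (tent s β 0) := hP' _ (tent_nonneg _ _ _)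
  have b1 := (u j hj).2
  have b2 := (u' j hj).1
  have o : 0 ≤ Λ 1 := hP _ (by simp)
  have o' : 0 ≤ Λ' 1 := hP' _ (by simp)
  have hb := hbb j
  set X := Λ (tent s β 0)
  set X' := Λ' (tent s β 0)
  calc Λ' (tent s β j) * Λ 1 ≤ (K * (bb j * X')) * (2 * (K * (Z * X))) := by
        apply mul_le_mul b2 (by linarith) o (by positivity)
    _ = 2 * K ^ 2 * (bb j * X) * (Z * X') := by ring
    _ ≤ 2 * K ^ 2 * (K * Λ (tent s β j)) * (K * (10 * Λ' 1)) := by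
        have : 0 ≤ K * Λ (tent s β j) := mul_nonneg hKpos.le (hP _ (tent_nonneg _ _ _))
        gcongr
    _ = _ := by ring

lemma conf_cmp {β : ℝ} (hβ : Irrational β) {v V g} (hg : QPv v V g)
    (hc : Continuous g) {Λ Λ'} (hP : PosF Λ) (hC : ConfF g β Λ) (hP' : PosF Λ') (hC' : ConfF g β Λ')
    (φ : C(UnitAddCircle, ℝ)) (hφ : ∀ z, 0 ≤ φ z) :
    Λ' φ * Λ 1 ≤ 20 * (20 * Real.exp (10 * V) ^ 4) * (Λ φ * Λ' 1) := by
  set κ := 20 * Real.exp (10 * V) ^ 4 with hκ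
  have hκpos : 0 < κ := by positivity
  have o : 0 ≤ Λ 1 := hP _ (by simp)
  have o' : 0 ≤ Λ' 1 := hP' _ (by simp)
  have main : ∀ ω > 0, (1 / 2 * Λ' φ - 10 * ω * Λ' 1) * Λ 1 ≤ κ * (10 * (Λ φ + ω * Λ 1) * Λ' 1) := by
    intro ω hω
    have huc := CompactSpace.uniformContinuous_of_continuous φ.continuous
    rw [Metric.uniformContinuous_iff] at huc
    obtain ⟨δ, hδ, huc⟩ := huc ω hω
    obtain ⟨n, hn⟩ := exists_nat_gt (4 / δ)
    obtain ⟨s, ⟨p, hs⟩, hsn⟩ := (good_inf hβ).exists_gt n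
    have hs' : (0 : ℝ) < s := by exact_mod_cast hs.1
    have h4s : ((4 : ℕ) : ℝ) / s ≤ δ := by
      have : (n : ℝ) ≤ s := by exact_mod_cast hsn.le
      rw [div_lt_iff₀ hδ] at hn
      rw [div_le_iff₀ hs']
      push_cast
      nlinarith
    let y : ℕ → UnitAddCircle := fun j => -(j • (β : UnitAddCircle))
    have near : ∀ j z, (φ z - ω) * tent s β j z ≤ φ (y j) * tent s β j z ∧
        φ (y j) * tent s β j z ≤ (φ z + ω) * tent s β j z := by
      intro j z
      by_cases hz : ‖z + j • (β : UnitAddCircle)‖ < (4 : ℕ) / s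
      · have h1 : dist (φ z) (φ (y j)) < ω := by
          apply huc
          rw [dist_eq_norm]
          simp only [y, sub_neg_eq_add]
          linarith
        rw [Real.dist_eq, abs_lt] at h1
        have := tent_nonneg s (β : UnitAddCircle) j z
        constructor <;> apply mul_le_mul_of_nonneg_right _ this <;> linarith [h1.1, h1.2]
      · rw [tent_supp hs.1 hz]; simp
    have up : ∑ j ∈ range s, φ (y j) * Λ (tent s β j) ≤ 10 * (Λ φ + ω * Λ 1) := by
      calc ∑ j ∈ range s, φ (y j) * Λ (tent s β j)
          = Λ (∑ j ∈ range s, φ (y j) • tent s β j) := by simp [map_sum]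
        _ ≤ Λ ((10 : ℝ) • (φ + ω • 1)) := by
          apply hP.mono
          intro z
          simp only [ContinuousMap.coe_sum, Finset.sum_apply, ContinuousMap.smul_apply,
            ContinuousMap.add_apply, ContinuousMap.one_apply, smul_eq_mul, mul_one]
          calc ∑ j ∈ range s, φ (y j) * tent s β j z
              ≤ ∑ j ∈ range s, (φ z + ω) * tent s β j z := sum_le_sum fun j _ => (near j z).2
            _ = (φ z + ω) * ∑ j ∈ range s, tent s β j z := by rw [mul_sum]
            _ ≤ (φ z + ω) * 10 := by
              apply mul_le_mul_of_nonneg_left (tent_sum_le hs z)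
              linarith [hφ z]
            _ = _ := by ring
        _ = _ := by rw [map_smul, map_add, map_smul, smul_eq_mul, smul_eq_mul]
    have lo : 1 / 2 * Λ' φ - 10 * ω * Λ' 1 ≤ ∑ j ∈ range s, φ (y j) * Λ' (tent s β j) := by
      calc 1 / 2 * Λ' φ - 10 * ω * Λ' 1 = Λ' ((1 / 2 : ℝ) • φ - (10 * ω) • 1) := by
            rw [map_sub, map_smul, map_smul, smul_eq_mul, smul_eq_mul]
        _ ≤ Λ' (∑ j ∈ range s, φ (y j) • tent s β j) := by
          apply hP'.mono
          intro z
          simp only [ContinuousMap.coe_sum, Finset.sum_apply, ContinuousMap.smul_apply,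
            ContinuousMap.sub_apply, ContinuousMap.one_apply, smul_eq_mul, mul_one]
          calc 1 / 2 * φ z - 10 * ω ≤ (φ z - ω) * ∑ j ∈ range s, tent s β j z := by
                have h1 := tent_sum_le hs z
                have h2 := tent_sum_ge hs z
                nlinarith [hφ z]
            _ = ∑ j ∈ range s, (φ z - ω) * tent s β j z := by rw [mul_sum]
            _ ≤ _ := sum_le_sum fun j _ => (near j z).1
        _ = _ := by simp [map_sum]
    calc (1 / 2 * Λ' φ - 10 * ω * Λ' 1) * Λ 1
        ≤ (∑ j ∈ range s, φ (y j) * Λ' (tent s β j)) * Λ 1 := mul_le_mul_of_nonneg_right lo o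
      _ = ∑ j ∈ range s, φ (y j) * (Λ' (tent s β j) * Λ 1) := by
        rw [sum_mul]; exact sum_congr rfl fun _ _ => by ring
      _ ≤ ∑ j ∈ range s, φ (y j) * (κ * (Λ (tent s β j) * Λ' 1)) := by
        refine sum_le_sum fun j hj => mul_le_mul_of_nonneg_left ?_ (hφ _)
        exact tent_cmp2 hs hg hc hP hC hP' hC' (mem_range.1 hj)
      _ = κ * ((∑ j ∈ range s, φ (y j) * Λ (tent s β j)) * Λ' 1) := by
        rw [sum_mul, mul_sum]; exact sum_congr rfl fun _ _ => by ring
      _ ≤ _ := by gcongr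
  set M := 20 * (Λ' 1 * Λ 1) + κ * (20 * (Λ 1 * Λ' 1)) + 1 with hM
  have hMpos : 0 < M := by positivity
  refine le_of_forall_pos_le_add fun e he => ?_
  have := main (e / M) (by positivity)
  have h2 : e / M * M = e := by field_simp
  have hx : 0 ≤ e / M := by positivity
  set x := e / M
  have : Λ' φ * Λ 1 ≤ 20 * κ * (Λ φ * Λ' 1) + x * (M - 1) := by
    rw [hM]; linarith
  linarith

lemma conf_le {β : ℝ} (hβ : Irrational β) {v V g} (hg : QPv v V g)
    (hc : Continuous g) {Λ Λ'} (hP : PosF Λ) (hC : ConfF g β Λ) (hP' : PosF Λ') (hC' : ConfF g β Λ')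
    (h1 : Λ 1 = 1) (h1' : Λ' 1 = 1) (φ : C(UnitAddCircle, ℝ)) (hφ : ∀ z, 0 ≤ φ z) :
    Λ' φ ≤ Λ φ := by
  set K := 20 * (20 * Real.exp (10 * V) ^ 4) + 1 with hK
  have hK1 : 1 < K := by rw [hK]; have : 0 < Real.exp (10 * V) := Real.exp_pos _; simp; positivity
  set r := 1 - K⁻¹ with hr
  have hKi : 0 < K⁻¹ := by positivity
  have hKi1 : K⁻¹ < 1 := inv_lt_one_of_one_lt₀ hK1
  have ind : ∀ n : ℕ, PosF (Λ - (1 - r ^ n) • Λ') := by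
    intro n
    induction n with
    | zero => simpa using hP
    | succ n ih =>
      intro φ hφ
      have hCD : ConfF g β (Λ - (1 - r ^ n) • Λ') := by
        intro φ ψ hψ
        simp only [LinearMap.sub_apply, LinearMap.smul_apply]
        rw [hC φ ψ hψ, hC' φ ψ hψ]
      have := conf_cmp hβ hg hc ih hCD hP' hC' φ hφ
      have hD := ih φ hφ
      simp only [LinearMap.sub_apply, LinearMap.smul_apply, smul_eq_mul, h1, h1', mul_one] at this hD ⊢
      rw [sub_sub_cancel] at this
      have h3 : Λ' φ * r ^ n ≤ K * (Λ φ - (1 - r ^ n) * Λ' φ) := by rw [hK]; linarith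
      have h4 : K⁻¹ * (Λ' φ * r ^ n) ≤ Λ φ - (1 - r ^ n) * Λ' φ := by
        rw [inv_mul_le_iff₀ (by positivity)]; exact h3
      rw [pow_succ]
      have : r ^ n * r = r ^ n - K⁻¹ * r ^ n := by rw [hr]; ring
      rw [this]
      nlinarith
  have lim : Tendsto (fun n : ℕ => Λ φ - (1 - r ^ n) * Λ' φ) atTop (nhds (Λ φ - (1 - 0) * Λ' φ)) := by
    have := tendsto_pow_atTop_nhds_zero_of_lt_one (r := r) (by rw [hr]; linarith) (by rw [hr]; linarith)
    exact ((this.const_sub 1).mul_const _).const_sub _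
  have := ge_of_tendsto' lim (fun n => ind n φ hφ)
  linarith

lemma conf_unique {β : ℝ} (hβ : Irrational β) {v V g} (hg : QPv v V g)
    (hc : Continuous g) {Λ Λ'} (hP : PosF Λ) (hC : ConfF g β Λ) (hP' : PosF Λ') (hC' : ConfF g β Λ')
    (h1 : Λ 1 = 1) (h1' : Λ' 1 = 1) : Λ = Λ' := by
  ext φ
  have hpos : ∀ z, 0 ≤ (φ + ‖φ‖ • (1 : C(UnitAddCircle, ℝ))) z := by
    intro z
    have := (abs_le.mp (φ.norm_coe_le_norm z)).1
    simp
    linarith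
  have a := conf_le hβ hg hc hP hC hP' hC' h1 h1' _ hpos
  have b := conf_le hβ hg hc hP' hC' hP hC h1' h1 _ hpos
  simp only [map_add, map_smul, h1, h1'] at a b
  linarith

lemma int_c (ν : Measure UnitAddCircle) [IsFiniteMeasure ν] {h : UnitAddCircle → ℝ}
    (hc : Continuous h) : Integrable h ν :=
  hc.integrable_of_hasCompactSupport (HasCompactSupport.of_compactSpace h)

def intF (ν : Measure UnitAddCircle) [IsFiniteMeasure ν] (Q : C(UnitAddCircle, ℝ)) :
    C(UnitAddCircle, ℝ) →ₗ[ℝ] ℝ where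
  toFun φ := ∫ z, φ z * Q z ∂ν
  map_add' φ ψ := by
    rw [← integral_add (int_c ν (by fun_prop)) (int_c ν (by fun_prop))]
    congr 1; ext z; simp; ring
  map_smul' c φ := by
    simp only [ContinuousMap.smul_apply, smul_eq_mul, RingHom.id_apply]
    rw [← integral_const_mul]
    congr 1; ext z; ring

lemma intF_pos (ν : Measure UnitAddCircle) [IsFiniteMeasure ν] (Q : C(UnitAddCircle, ℝ))
    (hQ : ∀ z, 0 ≤ Q z) : PosF (intF ν Q) := fun φ hφ =>
  integral_nonneg fun z => mul_nonneg (hφ z) (hQ z)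

lemma int_pos_of (ν : Measure UnitAddCircle) [IsProbabilityMeasure ν] {h : UnitAddCircle → ℝ}
    (hc : Continuous h) (hp : ∀ z, 0 < h z) : 0 < ∫ z, h z ∂ν := by
  rw [integral_pos_iff_support_of_nonneg (fun z => (hp z).le) (int_c ν hc)]
  have : Function.support h = Set.univ := by
    ext z; simp [(hp z).ne']
  rw [this, measure_univ]; exact one_pos

lemma pOf_cont {f : UnitAddCircle → ℝ} (hf : Continuous f) : Continuous (pOf f) := by
  unfold pOf
  refine Continuous.div (by fun_prop) (by fun_prop) (fun z => by positivity)

lemma one_sub_pOf (f : UnitAddCircle → ℝ) (z) : 1 - pOf f z = 1 / (1 + Real.exp (f z)) := by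
  unfold pOf
  field_simp
  ring

lemma pOf_pos (f : UnitAddCircle → ℝ) (z) : 0 < pOf f z := by unfold pOf; positivity

lemma one_sub_pOf_pos (f : UnitAddCircle → ℝ) (z) : 0 < 1 - pOf f z := by
  rw [one_sub_pOf]; positivity

lemma pOf_eq (f : UnitAddCircle → ℝ) (z) : pOf f z = Real.exp (f z) * (1 - pOf f z) := by
  rw [one_sub_pOf]; unfold pOf; ring

lemma Pop_fin {f : UnitAddCircle → ℝ} (hf : Continuous f) (α : ℝ) (ν : Measure UnitAddCircle)
    [IsFiniteMeasure ν] : IsFiniteMeasure (Pop (pOf f) α ν) := by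
  have hp := pOf_cont hf
  have h1 := isFiniteMeasure_withDensity_ofReal (int_c ν hp).2
  have h2 := isFiniteMeasure_withDensity_ofReal (int_c ν (h := fun z => 1 - pOf f z) (by fun_prop)).2
  unfold Pop
  infer_instance

lemma Pop_int {f : UnitAddCircle → ℝ} (hf : Continuous f) (α : ℝ) (ν : Measure UnitAddCircle)
    [IsFiniteMeasure ν] {φ : UnitAddCircle → ℝ} (hφ : Continuous φ) :
    ∫ z, φ z ∂(Pop (pOf f) α ν) = ∫ z, pOf f z * φ (z + (α : UnitAddCircle)) ∂ν +
      ∫ z, (1 - pOf f z) * φ (z - (α : UnitAddCircle)) ∂ν := by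
  have hp := pOf_cont hf
  have h1 := isFiniteMeasure_withDensity_ofReal (int_c ν hp).2
  have h2 := isFiniteMeasure_withDensity_ofReal (int_c ν (h := fun z => 1 - pOf f z) (by fun_prop)).2
  unfold Pop
  rw [integral_add_measure (int_c _ hφ) (int_c _ hφ)]
  rw [integral_map (by fun_prop) hφ.aestronglyMeasurable,
    integral_map (by fun_prop) hφ.aestronglyMeasurable]
  rw [integral_withDensity_eq_integral_toReal_smul (by fun_prop) (by simp),
    integral_withDensity_eq_integral_toReal_smul (by fun_prop) (by simp)]
  congr 1
  · congr 1; ext z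
    rw [ENNReal.toReal_ofReal (pOf_pos f z).le, smul_eq_mul]
  · congr 1; ext z
    rw [ENNReal.toReal_ofReal (one_sub_pOf_pos f z).le, smul_eq_mul]

lemma conf_measure_eq {α : ℝ} (hα : Irrational α) {f : UnitAddCircle → ℝ} (hf : Continuous f)
    {v V} (hv : QPv v V f) {μ : Measure UnitAddCircle}
    (hμ : IsUniqueStationary (pOf f) α μ) (ν : Measure UnitAddCircle) [IsProbabilityMeasure ν]
    (Q : C(UnitAddCircle, ℝ)) (hQ : ∀ z, Q z = 1 - pOf f z)
    (hC : ConfF (fun z => f z + f (z + (α : UnitAddCircle))) ((2 * α : ℝ) : UnitAddCircle) (intF ν Q)) :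
    ν = μ := by
  set a : UnitAddCircle := (α : UnitAddCircle) with ha
  have h2a : ((2 * α : ℝ) : UnitAddCircle) = a + a := by rw [two_mul, AddCircle.coe_add]
  have hβ : Irrational (2 * α) := by exact_mod_cast hα.natCast_mul two_ne_zero
  have hg := QPv_double hv α
  have hgc : Continuous (fun z => f z + f (z + a)) := by fun_prop
  have hQpos : ∀ z, 0 < Q z := fun z => by rw [hQ]; exact one_sub_pOf_pos f z
  set Λ := intF ν Q with hΛ
  have hP : PosF Λ := intF_pos ν Q (fun z => (hQpos z).le)
  let Op : C(UnitAddCircle, ℝ) →ₗ[ℝ] C(UnitAddCircle, ℝ) :=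
    { toFun := fun φ => ⟨fun z => φ (z + a) * Real.exp (f z), by fun_prop⟩
      map_add' := fun φ ψ => by ext z; simp; ring
      map_smul' := fun c φ => by ext z; simp; ring }
  have hOp : ∀ φ z, Op φ z = φ (z + a) * Real.exp (f z) := fun φ z => rfl
  have hOO : ∀ φ, Λ (Op (Op φ)) = Λ φ := by
    intro φ
    apply hC
    intro z
    rw [hOp, hOp, h2a, Real.exp_add, add_assoc]; ring
  set Λ' := Λ.comp Op with hΛ'
  have hP' : PosF Λ' := fun φ hφ => hP _ (fun z => by
    rw [hOp]; exact mul_nonneg (hφ _) (Real.exp_pos _).le)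
  have hC' : ConfF (fun z => f z + f (z + a)) ((2 * α : ℝ) : UnitAddCircle) Λ' := by
    intro φ ψ hψ
    simp only [hΛ', LinearMap.comp_apply]
    apply hC
    intro z
    rw [hOp, hOp, hψ]
    rw [show z + ((2 * α : ℝ) : UnitAddCircle) + a = z + a + ((2 * α : ℝ) : UnitAddCircle) by abel]
    simp only [Real.exp_add]
    rw [h2a, show z + a + a = z + (a + a) by abel]
    ring
  have hc1 : 0 < Λ 1 := by
    have := int_pos_of ν Q.continuous hQpos
    simpa [hΛ, intF] using this
  have hc1' : 0 < Λ' 1 := by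
    have := int_pos_of ν (h := fun z => Real.exp (f z) * Q z) (by fun_prop)
      (fun z => mul_pos (Real.exp_pos _) (hQpos z))
    simpa [hΛ', hΛ, intF, hOp] using this
  have key : (Λ 1)⁻¹ • Λ = (Λ' 1)⁻¹ • Λ' := by
    refine conf_unique hβ hg hgc (Λ := (Λ 1)⁻¹ • Λ) (Λ' := (Λ' 1)⁻¹ • Λ') ?_ ?_ ?_ ?_ ?_ ?_
    · intro φ hφ
      exact mul_nonneg (by positivity) (hP φ hφ)
    · intro φ ψ h
      simp only [LinearMap.smul_apply, hC φ ψ h]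
    · intro φ hφ
      exact mul_nonneg (by positivity) (hP' φ hφ)
    · intro φ ψ h
      simp only [LinearMap.smul_apply, hC' φ ψ h]
    · simp [hc1.ne']
    · simp [hc1'.ne']
  set t := Λ' 1 / Λ 1 with ht
  have htpos : 0 < t := by positivity
  have hΛt : ∀ φ, Λ (Op φ) = t * Λ φ := by
    intro φ
    have := congrArg (fun L : C(UnitAddCircle, ℝ) →ₗ[ℝ] ℝ => L φ) key
    simp only [LinearMap.smul_apply, smul_eq_mul] at this
    change Λ' φ = _
    rw [ht]
    field_simp at this ⊢
    linarith
  have ht1 : t = 1 := by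
    have := hOO 1
    rw [hΛt, hΛt] at this
    have h2 : (t - 1) * (t + 1) = 0 := by
      have h3 : (t * t - 1) * Λ 1 = 0 := by linarith
      have := (mul_eq_zero.mp h3).resolve_right hc1.ne'
      linarith
    rcases mul_eq_zero.mp h2 with h | h <;> linarith
  have hinv : ∀ φ : UnitAddCircle → ℝ, Continuous φ →
      ∫ z, pOf f z * φ (z + a) ∂ν = ∫ z, (1 - pOf f z) * φ z ∂ν := by
    intro φ hφ
    have := hΛt ⟨φ, hφ⟩
    rw [ht1, one_mul] at this
    simp only [hΛ, intF, LinearMap.coe_mk, AddHom.coe_mk, hOp, ContinuousMap.coe_mk] at this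
    convert this using 2
    · ext z; rw [hQ]; conv_lhs => rw [pOf_eq]
      ring
    · ext z; rw [hQ]; ring
  have hst : Pop (pOf f) α ν = ν := by
    have := Pop_fin hf α ν
    have hp := pOf_cont hf
    apply ext_of_forall_integral_eq_of_IsFiniteMeasure
    intro φ
    have hφ : Continuous φ := φ.continuous
    rw [Pop_int hf α ν hφ, hinv φ hφ]
    have h2 := hinv (fun z => φ (z - a)) (by fun_prop)
    simp only [add_sub_cancel_right] at h2
    rw [← h2, ← integral_add (int_c ν (by fun_prop)) (int_c ν (by fun_prop))]
    congr 1; ext z; ring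
  exact hμ.2.2 ν inferInstance hst

lemma exists_PM (n : ℕ) (w : ℕ → ℝ) (hw : ∀ j, 0 ≤ w j) (h1 : ∑ j ∈ range n, w j = 1)
    (P : ℕ → UnitAddCircle) : ∃ ν : ProbabilityMeasure UnitAddCircle,
      ∀ ψ : UnitAddCircle → ℝ, Continuous ψ →
        ∫ z, ψ z ∂(ν : Measure UnitAddCircle) = ∑ j ∈ range n, w j * ψ (P j) := by
  let m : Measure UnitAddCircle := ∑ j ∈ range n, ENNReal.ofReal (w j) • Measure.dirac (P j)
  have hm : IsProbabilityMeasure m := by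
    constructor
    simp only [m, Measure.coe_finsetSum, Finset.sum_apply, Measure.smul_apply, measure_univ,
      smul_eq_mul, mul_one]
    rw [← ENNReal.ofReal_sum_of_nonneg (fun j _ => hw j), h1, ENNReal.ofReal_one]
  refine ⟨⟨m, hm⟩, fun ψ hψ => ?_⟩
  change ∫ z, ψ z ∂m = _
  simp only [m]
  rw [integral_finsetSum_measure (fun j _ => ?_)]
  · refine sum_congr rfl fun j _ => ?_
    rw [integral_smul_measure, integral_dirac, ENNReal.toReal_ofReal (hw j), smul_eq_mul]
  · exact (int_c _ hψ).smul_measure ENNReal.ofReal_ne_top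

lemma core {α : ℝ} (hα : Irrational α) {f : UnitAddCircle → ℝ} (h𝔣 : ZeroMeanBV f)
    {μ : Measure UnitAddCircle}
    (hμ : IsUniqueStationary (pOf f) α μ) (φ : C(UnitAddCircle, ℝ)) (ε : ℝ) (hε : 0 < ε)
    {g : UnitAddCircle → ℝ} (hgdef : g = fun z => f z + f (z + (α : UnitAddCircle)))
    {b : UnitAddCircle} (hb : b = ((2 * α : ℝ) : UnitAddCircle)) :
    ∃ J0 : ℕ, ∀ J ≥ J0, ∀ y : UnitAddCircle,
      |(∑ j ∈ range J, Real.exp (Bsum g b j y) * (1 + Real.exp (f (y + j • b))) * φ (y + j • b)) /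
        (∑ j ∈ range J, Real.exp (Bsum g b j y) * (1 + Real.exp (f (y + j • b)))) - ∫ z, φ z ∂μ| < ε := by
  obtain ⟨hf, hbv, h0⟩ := h𝔣
  obtain ⟨v, V, hv⟩ := exists_QPv f hbv
  have hβ : Irrational (2 * α) := by exact_mod_cast hα.natCast_mul two_ne_zero
  have hg := QPv_double hv α
  rw [← hgdef] at hg
  have hgc : Continuous g := by rw [hgdef]; fun_prop
  have hg0 : ∫ z, g z = 0 := by
    rw [hgdef, integral_add (int_of_cont hf) (int_of_cont (by fun_prop)),
      integral_add_right_eq_self (μ := (volume : Measure UnitAddCircle)) f, h0, add_zero]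
  by_contra! hcon
  choose J hJ y hy using fun n : ℕ => hcon (n + 1)
  let w : ℕ → ℕ → ℝ := fun n j => Real.exp (Bsum g b j (y n)) * (1 + Real.exp (f (y n + j • b)))
  let W : ℕ → ℝ := fun n => ∑ j ∈ range (J n), w n j
  have hwpos : ∀ n j, 0 < w n j := fun n j => by positivity
  have hWpos : ∀ n, 0 < W n := fun n =>
    sum_pos (fun j _ => hwpos n j) ⟨0, mem_range.2 (by have := hJ n; omega)⟩
  choose P hPM using fun n => exists_PM (J n) (fun j => w n j / W n)
    (fun j => div_nonneg (hwpos n j).le (hWpos n).le)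
    (by rw [← sum_div]; exact div_self (hWpos n).ne') (fun j => y n + j • b)
  let U : Ultrafilter ℕ := hyperfilter ℕ
  have hU : (U : Filter ℕ) ≤ atTop := by
    rw [← Nat.cofinite_eq_atTop]; exact hyperfilter_le_cofinite
  obtain ⟨ν, -, hν⟩ := isCompact_univ.ultrafilter_le_nhds (U.map P) (by simp)
  have hlim : ∀ ψ : UnitAddCircle → ℝ, Continuous ψ →
      Tendsto (fun n => ∑ j ∈ range (J n), w n j / W n * ψ (y n + j • b)) U
        (nhds (∫ z, ψ z ∂(ν : Measure UnitAddCircle))) := by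
    intro ψ hψ
    have hT : Tendsto P U (nhds ν) := hν
    have := ProbabilityMeasure.tendsto_iff_forall_integral_tendsto.1 hT
      (BoundedContinuousFunction.mkOfCompact ⟨ψ, hψ⟩)
    simp only [BoundedContinuousFunction.mkOfCompact_apply, ContinuousMap.coe_mk] at this
    convert this using 2 with n
    rw [hPM n ψ hψ]
  have hp := pOf_cont hf
  let Q : C(UnitAddCircle, ℝ) := ⟨fun z => 1 - pOf f z, by fun_prop⟩
  have hC : ConfF g b (intF (ν : Measure UnitAddCircle) Q) := by
    intro φ ψ hψ
    have l1 := (hlim (fun z => ψ z * Q z) (by fun_prop)).sub (hlim (fun z => φ z * Q z) (by fun_prop))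
    have e1 : ∀ n, ∑ j ∈ range (J n), w n j / W n * (ψ (y n + j • b) * Q (y n + j • b)) -
        ∑ j ∈ range (J n), w n j / W n * (φ (y n + j • b) * Q (y n + j • b)) =
        (Real.exp (Bsum g b (J n) (y n)) * φ (y n + J n • b) - φ (y n)) / W n := by
      intro n
      have e2 := sum_range_sub (fun j => Real.exp (Bsum g b j (y n)) * φ (y n + j • b)) (J n)
      simp only [Bsum_zero, Real.exp_zero, one_mul, zero_smul, add_zero] at e2
      rw [← e2, ← sum_sub_distrib, sum_div]
      refine sum_congr rfl fun j _ => ?_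
      have e3 : w n j * Q (y n + j • b) = Real.exp (Bsum g b j (y n)) := by
        simp only [w, Q, ContinuousMap.coe_mk, one_sub_pOf]
        field_simp
      have e4 : y n + (j + 1) • b = y n + j • b + b := by rw [add_smul, one_smul]; abel
      rw [hψ, Bsum_succ, Real.exp_add, e4, ← e3]
      field_simp
    simp only [e1] at l1
    have l2 : Tendsto (fun n => (Real.exp (Bsum g b (J n) (y n)) * φ (y n + J n • b) - φ (y n)) / W n)
        atTop (nhds 0) := by
      rw [Metric.tendsto_atTop]
      intro e he
      set N := 2 * (‖φ‖ + 1) / e with hN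
      have hNpos : 0 < N := by positivity
      obtain ⟨J0, hJ0⟩ := growth hβ hg hgc hg0 N
      refine ⟨J0, fun n hn => ?_⟩
      obtain ⟨g1, g2⟩ := hJ0 (J n) (by have := hJ n; omega) (y n)
      rw [← hb] at g1 g2
      have hWge : ∑ j ∈ range (J n), Real.exp (Bsum g b j (y n)) ≤ W n := by
        refine sum_le_sum fun j _ => ?_
        have : 0 < Real.exp (f (y n + j • b)) := Real.exp_pos _
        have : 0 < Real.exp (Bsum g b j (y n)) := Real.exp_pos _
        simp only [w]
        nlinarith
      rw [Real.dist_eq, sub_zero, abs_div, abs_of_pos (hWpos n), div_lt_iff₀ (hWpos n)]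
      have b1 := φ.norm_coe_le_norm (y n + J n • b)
      have b2 := φ.norm_coe_le_norm (y n)
      rw [Real.norm_eq_abs] at b1 b2
      set E := Real.exp (Bsum g b (J n) (y n))
      have hE : 0 < E := Real.exp_pos _
      calc |E * φ (y n + J n • b) - φ (y n)| ≤ |E * φ (y n + J n • b)| + |φ (y n)| := abs_sub _ _
        _ ≤ E * ‖φ‖ + ‖φ‖ := by rw [abs_mul, abs_of_pos hE]; gcongr
        _ < (E + 1) * (‖φ‖ + 1) := by nlinarith
        _ = e * ((N * E + N) / 2) := by rw [hN]; field_simp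
        _ ≤ e * W n := by
          apply mul_le_mul_of_nonneg_left _ he.le
          linarith
    have := tendsto_nhds_unique l1 (l2.mono_left hU)
    exact sub_eq_zero.mp this
  have hνμ : (ν : Measure UnitAddCircle) = μ := by
    refine conf_measure_eq hα hf hv hμ _ Q (fun z => rfl) ?_
    rw [← hb, ← hgdef]; exact hC
  have l := hlim φ φ.continuous
  rw [hνμ] at l
  have l3 := (l.sub_const (∫ z, φ z ∂μ)).abs
  rw [sub_self, abs_zero] at l3
  have : ε ≤ 0 := by
    refine ge_of_tendsto' l3 fun n => ?_
    have h := hy n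
    refine h.trans (le_of_eq ?_)
    refine congrArg (fun t => |t - ∫ z, φ z ∂μ|) ?_
    rw [sum_div]
    exact sum_congr rfl fun j _ => by simp only [w, W]; ring
  linarith

lemma renewal (a : ℕ → ℕ → ℝ) (ha : ∀ n k, 0 ≤ a n k) (S p q r : ℕ → ℝ)
    (hq : ∀ k, 0 < q k) (hpq : ∀ k, p k + q k = 1)
    (hp : ∀ k, p k = Real.exp (S (k + 1) - S k) * q k) (hS0 : S 0 = 0)
    (hS : ∀ N : ℝ, ∃ K : ℕ, N ≤ ∑ k ∈ range K, Real.exp (-S k))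
    (hr : ∀ k, r k * q k = q 0 * Real.exp (S k))
    (h1 : a 0 1 = p 0) (h2 : ∀ k, a 0 (k + 2) = 0)
    (h3 : ∀ n, a (n + 1) 1 = a n 2 * q 2)
    (h4 : ∀ n k, a (n + 1) (k + 2) = a n (k + 1) * p (k + 1) + a n (k + 3) * q (k + 3)) :
    ∀ k, ∑' n, a n (k + 1) = r (k + 1) := by
  have hpp : ∀ k, 0 < p k := fun k => by rw [hp]; exact mul_pos (Real.exp_pos _) (hq k)
  have hrp : ∀ k, 0 < r k := fun k => by
    have : 0 < r k * q k := by rw [hr]; exact mul_pos (hq 0) (Real.exp_pos _)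
    exact pos_of_mul_pos_left this (hq k).le
  have hr0 : r 0 = 1 := by
    have := hr 0
    rw [hS0, Real.exp_zero, mul_one] at this
    exact mul_right_cancel₀ (hq 0).ne' (by rw [this, one_mul])
  have hdb : ∀ k, r k * p k = r (k + 1) * q (k + 1) := fun k => by
    rw [hr, hp, show r k * (Real.exp (S (k+1) - S k) * q k) = r k * q k * Real.exp (S (k+1) - S k) by ring,
      hr, mul_assoc, ← Real.exp_add]; congr 2; ring
  have hrr : ∀ k, r (k + 1) = r k * p k + r (k + 2) * q (k + 2) := fun k => by
    rw [hdb k, ← hdb (k + 1), ← mul_add, add_comm (q _), hpq, mul_one]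
  have hb : ∀ N k, ∑ n ∈ range N, a n (k + 1) ≤ r (k + 1) := by
    intro N
    induction N with
    | zero => intro k; simpa using (hrp _).le
    | succ N ih =>
      intro k
      rw [sum_range_succ']
      cases k with
      | zero =>
        simp only [zero_add, h3, h1]
        rw [← sum_mul, hrr 0, hr0, one_mul, add_comm]
        have := mul_le_mul_of_nonneg_right (ih 1) (hq 2).le
        simpa using this
      | succ k =>
        have e : ∀ n, a (n + 1) (k + 1 + 1) = a n (k + 1) * p (k + 1) + a n (k + 3) * q (k + 3) := fun n => h4 n k
        simp only [e]
        rw [h2, add_zero, sum_add_distrib, ← sum_mul, ← sum_mul, hrr (k + 1)]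
        exact add_le_add (mul_le_mul_of_nonneg_right (ih k) (hpp _).le)
          (mul_le_mul_of_nonneg_right (ih (k + 2)) (hq _).le)
  have hsum : ∀ k, Summable fun n => a n (k + 1) := fun k =>
    summable_of_sum_range_le (fun n => ha n _) (fun N => hb N k)
  have hle : ∀ k, ∑' n, a n (k + 1) ≤ r (k + 1) := fun k =>
    Real.tsum_le_of_sum_range_le (fun n => ha n _) (fun N => hb N k)
  let d : ℕ → ℝ := fun k => match k with
    | 0 => 0
    | k + 1 => r (k + 1) - ∑' n, a n (k + 1)
  have hd0 : d 0 = 0 := rfl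
  have hds : ∀ k, d (k + 1) = r (k + 1) - ∑' n, a n (k + 1) := fun k => rfl
  have hdn : ∀ k, 0 ≤ d k := fun k => by
    cases k with
    | zero => exact le_rfl
    | succ k => rw [hds]; linarith [hle k]
  have hdr : ∀ k, d k ≤ r k := fun k => by
    cases k with
    | zero => exact (hrp 0).le
    | succ k =>
      rw [hds]
      have : 0 ≤ ∑' n, a n (k + 1) := tsum_nonneg (fun n => ha n (k + 1))
      linarith
  have hdd : ∀ k, d (k + 1) = d k * p k + d (k + 2) * q (k + 2) := by
    intro k
    cases k with
    | zero =>
      rw [hd0, hds, hds 1, (hsum 0).tsum_eq_zero_add, hrr 0]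
      simp only [zero_add, h3, h1, tsum_mul_right, hr0]
      norm_num
      ring
    | succ k =>
      rw [hds, hds k, hds (k + 2), (hsum (k + 1)).tsum_eq_zero_add, hrr (k + 1)]
      have e : ∀ n, a (n + 1) (k + 1 + 1) = a n (k + 1) * p (k + 1) + a n (k + 3) * q (k + 3) := fun n => h4 n k
      simp only [e]
      rw [h2, ((hsum k).mul_right _).tsum_add ((hsum (k + 2)).mul_right _), tsum_mul_right,
        tsum_mul_right]
      ring
  set c := d 1 * q 1 with hc
  have hcn : 0 ≤ c := mul_nonneg (hdn 1) (hq 1).le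
  have hcc : ∀ k, d (k + 1) * q (k + 1) = d k * p k + c := by
    intro k
    induction k with
    | zero => rw [hd0]; simp [hc]
    | succ k ih =>
      have e1 : d (k + 1) = d (k + 1) * p (k + 1) + d (k + 1) * q (k + 1) := by
        rw [← mul_add, hpq, mul_one]
      have e2 := hdd k
      rw [show k + 1 + 1 = k + 2 by ring]
      linarith
  have hu : ∀ K, d K * q K * Real.exp (-S K) = c * (∑ k ∈ range K, Real.exp (-S (k + 1))) := by
    intro K
    induction K with
    | zero => simp [hd0]
    | succ K ih =>
      rw [sum_range_succ, mul_add, ← ih, hcc, hp, add_mul]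
      congr 1
      rw [show d K * (Real.exp (S (K+1) - S K) * q K) * Real.exp (-S (K+1)) =
        d K * q K * (Real.exp (S (K+1) - S K) * Real.exp (-S (K+1))) by ring, ← Real.exp_add]
      congr 2; ring
  have hub : ∀ K, c * (∑ k ∈ range K, Real.exp (-S (k + 1))) ≤ 1 := by
    intro K
    rw [← hu]
    calc d K * q K * Real.exp (-S K) ≤ r K * q K * Real.exp (-S K) := by
          gcongr
          · exact (hq K).le
          · exact hdr K
      _ = q 0 := by rw [hr, mul_assoc, ← Real.exp_add]; simp
      _ ≤ 1 := by linarith [hpq 0, hpp 0]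
  have hc0 : c = 0 := by
    by_contra hne
    have hcp : 0 < c := lt_of_le_of_ne hcn (Ne.symm hne)
    obtain ⟨K, hK⟩ := hS (1 / c + 2)
    have h5 := hub K
    have h6 : ∑ k ∈ range K, Real.exp (-S k) ≤ 1 + ∑ k ∈ range K, Real.exp (-S (k + 1)) := by
      have e1 := sum_range_succ (fun k => Real.exp (-S k)) K
      have e2 := sum_range_succ' (fun k => Real.exp (-S k)) K
      have e3 := Real.exp_pos (-S K)
      rw [hS0, neg_zero, Real.exp_zero] at e2
      linarith
    have h7 : 1 / c + 1 ≤ ∑ k ∈ range K, Real.exp (-S (k + 1)) := by linarith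
    have h8 := mul_le_mul_of_nonneg_left h7 hcn
    have h9 : c * (1 / c + 1) = 1 + c := by field_simp
    linarith
  intro k
  have h5 := hu (k + 1)
  rw [hc0, zero_mul] at h5
  have h6 : d (k + 1) = 0 := by
    rcases mul_eq_zero.1 h5 with h | h
    · rcases mul_eq_zero.1 h with h | h
      · exact h
      · exact absurd h (hq _).ne'
    · exact absurd h (Real.exp_pos _).ne'
  rw [hds] at h6
  linarith

lemma walk_markov {𝔭 : UnitAddCircle → ℝ} {α : ℝ} {x : UnitAddCircle}
    {Ω : Type} [MeasurableSpace Ω] {ℙ : Measure Ω} {ξ : ℕ → Ω → ℤ}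
    (hp0 : ∀ z, 0 ≤ 𝔭 z) (hp1 : ∀ z, 𝔭 z ≤ 1)
    (h : IsQPWalk 𝔭 α x 0 ℙ ξ) (n : ℕ) (j a : ℤ) (B : Set (Fin (n + 1) → ℤ)) :
    ℙ {ω | (fun i : Fin (n + 1) => ξ i ω) ∈ B ∧ ξ n ω = j ∧ ξ (n + 1) ω = a} =
      ℙ {ω | (fun i : Fin (n + 1) => ξ i ω) ∈ B ∧ ξ n ω = j} *
        ENNReal.ofReal (stepProb 𝔭 α x j a) := by
  obtain ⟨hP, hm, hfd⟩ := h
  have hst : ∀ j a, 0 ≤ stepProb 𝔭 α x j a := fun j a => by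
    unfold stepProb
    split_ifs
    · exact hp0 _
    · linarith [hp1 (pt α x j)]
    · exact le_rfl
  let X : Ω → (Fin (n + 1) → ℤ) := fun ω i => ξ i ω
  have hX : Measurable X := measurable_pi_lambda _ fun i => hm i
  have hA : MeasurableSet {ω | ξ (n + 1) ω = a} := hm (n + 1) (measurableSet_singleton a)
  have key : (ℙ.restrict {ω | ξ (n + 1) ω = a}).map X =
      (ℙ.map X).withDensity (fun b => ENNReal.ofReal (stepProb 𝔭 α x (b (Fin.last n)) a)) := by
    refine Measure.ext_of_singleton fun b => ?_
    rw [Measure.map_apply hX (measurableSet_singleton b),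
      Measure.restrict_apply (hX (measurableSet_singleton b)),
      withDensity_apply _ (measurableSet_singleton b), lintegral_singleton,
      Measure.map_apply hX (measurableSet_singleton b)]
    let k : ℕ → ℤ := fun i => if hi : i < n + 1 then b ⟨i, hi⟩ else a
    have e1 : X ⁻¹' {b} = {ω | ∀ i ≤ n, ξ i ω = k i} := by
      ext ω
      simp only [Set.mem_preimage, Set.mem_singleton_iff, Set.mem_ofPred_eq, funext_iff, X]
      constructor
      · intro h i hi
        have : i < n + 1 := by omega
        simp only [k, this, dif_pos]
        exact h ⟨i, this⟩
      · intro h i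
        have := h i (by omega)
        simpa only [k, i.2, dif_pos] using this
    have e2 : X ⁻¹' {b} ∩ {ω | ξ (n + 1) ω = a} = {ω | ∀ i ≤ n + 1, ξ i ω = k i} := by
      rw [e1]
      ext ω
      simp only [Set.mem_inter_iff, Set.mem_ofPred_eq]
      have hk : k (n + 1) = a := by simp [k]
      constructor
      · rintro ⟨h1, h2⟩ i hi
        rcases Nat.lt_or_ge n i with h | h
        · have : i = n + 1 := by omega
          subst this; rw [hk]; exact h2
        · exact h1 i h
      · intro h
        exact ⟨fun i hi => h i (by omega), hk ▸ h (n + 1) le_rfl⟩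
    rw [e2, e1, hfd, hfd, prod_range_succ, ← ENNReal.ofReal_mul (hst _ _)]
    congr 1
    have hk : k (n + 1) = a := by simp [k]
    have hk' : k n = b (Fin.last n) := by simp [k, Fin.last]
    rw [hk, hk']
    ring
  have hB : MeasurableSet (B ∩ {b | b (Fin.last n) = j}) := (Set.to_countable _).measurableSet
  have := congrArg (fun m => m (B ∩ {b | b (Fin.last n) = j})) key
  rw [Measure.map_apply hX hB, Measure.restrict_apply (hX hB), withDensity_apply _ hB] at this
  rw [setLIntegral_congr_fun hB (g := fun _ => ENNReal.ofReal (stepProb 𝔭 α x j a))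
    (fun b hb => by rw [show b (Fin.last n) = j from hb.2]), setLIntegral_const,
    Measure.map_apply hX hB] at this
  rw [mul_comm]
  convert this using 2
  · ext ω
    simp [X, and_assoc]
  · rfl

lemma walk_rec {𝔭 : UnitAddCircle → ℝ} {α : ℝ} {x : UnitAddCircle}
    {Ω : Type} [MeasurableSpace Ω] {ℙ : Measure Ω} {ξ : ℕ → Ω → ℤ}
    (hp0 : ∀ z, 0 ≤ 𝔭 z) (hp1 : ∀ z, 𝔭 z ≤ 1)
    (h : IsQPWalk 𝔭 α x 0 ℙ ξ) (n : ℕ) (a : ℤ) :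
    (ℙ (firstRetSet ξ (n + 2) a)).toReal =
      (if a - 1 = 0 then 0 else (ℙ (firstRetSet ξ (n + 1) (a - 1))).toReal * 𝔭 (pt α x (a - 1))) +
      (if a + 1 = 0 then 0 else (ℙ (firstRetSet ξ (n + 1) (a + 1))).toReal *
        (1 - 𝔭 (pt α x (a + 1)))) := by
  have hm := h.2.1
  have hP : IsProbabilityMeasure ℙ := h.1
  let B : Set (Fin (n + 1 + 1) → ℤ) := {b | ∀ i, 1 ≤ i.1 → b i ≠ 0}
  have hdec : firstRetSet ξ (n + 2) a =
      ⋃ j : ℤ, {ω | (fun i : Fin (n + 1 + 1) => ξ i ω) ∈ B ∧ ξ (n + 1) ω = j ∧ ξ (n + 1 + 1) ω = a} := by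
    ext ω
    simp only [firstRetSet, Set.mem_ofPred_eq, Set.mem_iUnion, B]
    constructor
    · rintro ⟨h1, h2⟩
      exact ⟨_, fun i hi => h1 i hi i.2, rfl, h2⟩
    · rintro ⟨j, h1, -, h2⟩
      exact ⟨fun i hi hi' => h1 ⟨i, hi'⟩ hi, h2⟩
  have hX : Measurable (fun ω => (fun i : Fin (n + 1 + 1) => ξ i ω)) :=
    measurable_pi_lambda _ fun i => hm i
  have hmB : MeasurableSet B := (Set.to_countable _).measurableSet
  have hms : ∀ j, MeasurableSet {ω | (fun i : Fin (n + 1 + 1) => ξ i ω) ∈ B ∧ ξ (n + 1) ω = j ∧ ξ (n + 1 + 1) ω = a} :=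
    fun j => (hX hmB).inter ((hm _ (measurableSet_singleton j)).inter (hm _ (measurableSet_singleton a)))
  have hj : ∀ j : ℤ, {ω | (fun i : Fin (n + 1 + 1) => ξ i ω) ∈ B ∧ ξ (n + 1) ω = j} =
      if j = 0 then ∅ else firstRetSet ξ (n + 1) j := by
    intro j
    split_ifs with h0
    · ext ω
      simp only [Set.mem_ofPred_eq, B, Set.mem_empty_iff_false, iff_false]
      rintro ⟨h1, h2⟩
      exact h1 (Fin.last (n + 1)) (by simp) (by simpa using h2.trans h0)
    · ext ω
      simp only [firstRetSet, Set.mem_ofPred_eq, B]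
      constructor
      · rintro ⟨h1, h2⟩
        exact ⟨fun i hi hi' => h1 ⟨i, by omega⟩ hi, h2⟩
      · rintro ⟨h1, h2⟩
        refine ⟨fun i hi => ?_, h2⟩
        rcases Nat.lt_or_ge i.1 (n + 1) with h | h
        · exact h1 i hi h
        · have : i.1 = n + 1 := by omega
          simp only [this]; rw [h2]; exact h0
  rw [hdec, measure_iUnion _ hms]
  · have hterm : ∀ j : ℤ, ℙ {ω | (fun i : Fin (n + 1 + 1) => ξ i ω) ∈ B ∧ ξ (n + 1) ω = j ∧ ξ (n + 1 + 1) ω = a}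
        = ℙ (if j = 0 then ∅ else firstRetSet ξ (n + 1) j) * ENNReal.ofReal (stepProb 𝔭 α x j a) := by
      intro j
      rw [walk_markov hp0 hp1 h (n + 1) j a B, hj]
    simp only [hterm]
    rw [tsum_eq_sum (s := {a - 1, a + 1}), sum_pair (by omega), ENNReal.toReal_add, ENNReal.toReal_mul,
      ENNReal.toReal_mul]
    · have s1 : stepProb 𝔭 α x (a - 1) a = 𝔭 (pt α x (a - 1)) := by simp [stepProb]
      have s2 : stepProb 𝔭 α x (a + 1) a = 1 - 𝔭 (pt α x (a + 1)) := by
        have : ¬ (a = a + 1 + 1) := by omega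
        simp [stepProb, this]
      rw [s1, s2, ENNReal.toReal_ofReal (hp0 _), ENNReal.toReal_ofReal (by linarith [hp1 (pt α x (a+1))])]
      congr 1
      · split_ifs <;> simp
      · split_ifs <;> simp
    · exact ENNReal.mul_ne_top (measure_ne_top _ _) ENNReal.ofReal_ne_top
    · exact ENNReal.mul_ne_top (measure_ne_top _ _) ENNReal.ofReal_ne_top
    · intro j hjn
      simp only [mem_insert, mem_singleton, not_or] at hjn
      have : stepProb 𝔭 α x j a = 0 := by
        unfold stepProb
        rw [if_neg (by omega), if_neg (by omega)]
      rw [this]; simp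
  · intro i j hij
    refine Set.disjoint_left.2 fun ω h1 h2 => hij ?_
    exact h1.2.1.symm.trans h2.2.1

lemma walk_init {𝔭 : UnitAddCircle → ℝ} {α : ℝ} {x : UnitAddCircle}
    {Ω : Type} [MeasurableSpace Ω] {ℙ : Measure Ω} {ξ : ℕ → Ω → ℤ}
    (hp0 : ∀ z, 0 ≤ 𝔭 z) (hp1 : ∀ z, 𝔭 z ≤ 1)
    (h : IsQPWalk 𝔭 α x 0 ℙ ξ) (a : ℤ) :
    (ℙ (firstRetSet ξ 1 a)).toReal = stepProb 𝔭 α x 0 a := by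
  have hP : IsProbabilityMeasure ℙ := h.1
  have hst : 0 ≤ stepProb 𝔭 α x 0 a := by
    unfold stepProb
    split_ifs
    · exact hp0 _
    · linarith [hp1 (pt α x 0)]
    · exact le_rfl
  have h0 : ℙ {ω | ξ 0 ω = 0} = 1 := by
    have := h.2.2 0 (fun _ => 0)
    simpa using this
  have hae : ∀ᵐ ω ∂ℙ, ξ 0 ω = 0 := by
    exact (prob_compl_eq_zero_iff (h.2.1 0 (measurableSet_singleton 0))).2 h0
  have h1 := h.2.2 1 (fun i => if i = 0 then 0 else a)
  have e : ℙ (firstRetSet ξ 1 a) = ℙ {ω | ∀ i ≤ 1, ξ i ω = if i = 0 then 0 else a} := by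
    refine measure_congr ?_
    filter_upwards [hae] with ω hω
    refine propext ?_
    change ((∀ i, 1 ≤ i → i < 1 → ξ i ω ≠ 0) ∧ ξ 1 ω = a) ↔ (∀ i ≤ 1, ξ i ω = if i = 0 then 0 else a)
    constructor
    · rintro ⟨-, h2⟩ i hi
      interval_cases i
      · simpa using hω
      · simpa using h2
    · intro h2
      exact ⟨fun i hi hi' => by omega, by simpa using h2 1 le_rfl⟩
  rw [e, h1]
  simp [ENNReal.toReal_ofReal hst]

lemma muW_zero {𝔭 : UnitAddCircle → ℝ} {α : ℝ} {x : UnitAddCircle}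
    {Ω : Type} [MeasurableSpace Ω] {ℙ : Measure Ω} {ξ : ℕ → Ω → ℤ}
    (h : IsQPWalk 𝔭 α x 0 ℙ ξ) : 0 ≤ muW ℙ ξ 0 ∧ muW ℙ ξ 0 ≤ 1 := by
  have hP : IsProbabilityMeasure ℙ := h.1
  have hm := h.2.1
  refine ⟨tsum_nonneg fun n => ENNReal.toReal_nonneg, ?_⟩
  unfold muW
  rw [← ENNReal.tsum_toReal_eq (fun n => measure_ne_top _ _)]
  have hms : ∀ n, MeasurableSet (firstRetSet ξ (n + 1) 0) := fun n => by
    have : firstRetSet ξ (n + 1) 0 =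
        (⋂ i : ℕ, {ω | 1 ≤ i → i < n + 1 → ξ i ω ≠ 0}) ∩ {ω | ξ (n + 1) ω = 0} := by
      ext ω; simp [firstRetSet]
    rw [this]
    refine (MeasurableSet.iInter fun i => ?_).inter (hm _ (measurableSet_singleton 0))
    by_cases h1 : 1 ≤ i <;> by_cases h2 : i < n + 1 <;> simp only [h1, h2, true_imp_iff, false_imp_iff, Set.ofPred_true, MeasurableSet.univ]
    exact (hm i (measurableSet_singleton 0)).compl
  rw [← measure_iUnion _ hms]
  · refine ENNReal.toReal_le_of_le_ofReal zero_le_one ?_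
    simpa using prob_le_one
  · intro i j hij
    refine Set.disjoint_left.2 fun ω h1 h2 => ?_
    rcases lt_or_gt_of_ne hij with hl | hl
    · exact h2.1 (i + 1) (by omega) (by omega) h1.2
    · exact h1.1 (j + 1) (by omega) (by omega) h2.2

lemma pt_nat (α : ℝ) (x : UnitAddCircle) (k : ℕ) : pt α x (k : ℤ) = x + k • (α : UnitAddCircle) := by
  unfold pt
  rw [← AddCircle.coe_nsmul]
  simp

lemma muW_eq {α : ℝ} (hα : Irrational α) {f : UnitAddCircle → ℝ} (h𝔣 : ZeroMeanBV f)
    {x : UnitAddCircle} {Ω : Type} [MeasurableSpace Ω] {ℙ : Measure Ω} {ξ : ℕ → Ω → ℤ}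
    (h : IsQPWalk (pOf f) α x 0 ℙ ξ) (k : ℕ) :
    muW ℙ ξ ((k + 1 : ℕ) : ℤ) = (1 - pOf f x) * (Real.exp (Bsum f α (k + 1) x) *
      (1 + Real.exp (f (x + (k + 1) • (α : UnitAddCircle))))) := by
  obtain ⟨hf, hbv, h0⟩ := h𝔣
  obtain ⟨v, V, hv⟩ := exists_QPv f hbv
  have hv' : QPv v V (fun z => - f z) := ⟨hv.1, fun u w huw => by
    have := hv.2 u w huw
    rw [← abs_neg] at this
    convert this using 2; ring⟩
  have hp0 : ∀ z, 0 ≤ pOf f z := fun z => (pOf_pos f z).le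
  have hp1 : ∀ z, pOf f z ≤ 1 := fun z => by linarith [one_sub_pOf_pos f z]
  have hBn : ∀ j z, Bsum (fun z => -f z) α j z = - Bsum f α j z := fun j z => by
    simp [Bsum]
  refine renewal (fun n k => (ℙ (firstRetSet ξ (n + 1) (k : ℤ))).toReal)
    (fun n k => ENNReal.toReal_nonneg) (fun k => Bsum f α k x)
    (fun k => pOf f (x + k • (α : UnitAddCircle))) (fun k => 1 - pOf f (x + k • (α : UnitAddCircle)))
    (fun k => (1 - pOf f x) * (Real.exp (Bsum f α k x) * (1 + Real.exp (f (x + k • (α : UnitAddCircle))))))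
    (fun k => one_sub_pOf_pos f _) (fun k => by ring) (fun k => ?_) (Bsum_zero _ _ _) (fun N => ?_)
    (fun k => ?_) ?_ (fun k => ?_) (fun n => ?_) (fun n k => ?_) k
  · rw [Bsum_succ, add_sub_cancel_left]; exact pOf_eq f _
  · obtain ⟨K, hK⟩ := growth hα hv' (by fun_prop) (by rw [integral_neg, h0, neg_zero]) N
    have := (hK K le_rfl x).1
    simp only [hBn] at this
    exact ⟨K, this⟩
  · simp only [one_sub_pOf, zero_smul, add_zero]
    field_simp
  · have := walk_init hp0 hp1 h 1
    simp only [zero_add, zero_smul, add_zero, Nat.cast_one]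
    rw [this]; simp [stepProb, pt]
  · have := walk_init hp0 hp1 h ((k + 2 : ℕ) : ℤ)
    simp only [zero_add]
    rw [this]; unfold stepProb; rw [if_neg (by omega), if_neg (by omega)]
  · have := walk_rec hp0 hp1 h n 1
    simp only [← pt_nat]
    simpa using this
  · have := walk_rec hp0 hp1 h n ((k + 2 : ℕ) : ℤ)
    simp only [← pt_nat]
    rw [if_neg (by omega), if_neg (by omega)] at this
    rw [show ((k + 2 : ℕ) : ℤ) - 1 = ((k + 1 : ℕ) : ℤ) by push_cast; ring,
      show ((k + 2 : ℕ) : ℤ) + 1 = ((k + 3 : ℕ) : ℤ) by push_cast; ring] at this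
    exact this

lemma sum_odd (q : ℕ) (F : ℕ → ℝ) :
    ∑ k ∈ (range q).filter (fun k => Odd k), F k = ∑ j ∈ range (q / 2), F (2 * j + 1) := by
  have : (range q).filter (fun k => Odd k) = (range (q / 2)).image (fun j => 2 * j + 1) := by
    ext k
    simp only [mem_filter, mem_range, mem_image]
    constructor
    · rintro ⟨h1, j, rfl⟩
      exact ⟨j, by omega, rfl⟩
    · rintro ⟨j, h1, rfl⟩
      exact ⟨by omega, j, rfl⟩
  rw [this, sum_image]
  intro a _ b _ h
  simp only at h
  omega

lemma sum_even (q : ℕ) (F : ℕ → ℝ) :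
    ∑ k ∈ (range q).filter (fun k => Even k), F k = ∑ j ∈ range ((q + 1) / 2), F (2 * j) := by
  have : (range q).filter (fun k => Even k) = (range ((q + 1) / 2)).image (fun j => 2 * j) := by
    ext k
    simp only [mem_filter, mem_range, mem_image]
    constructor
    · rintro ⟨h1, j, rfl⟩
      exact ⟨j, by omega, by omega⟩
    · rintro ⟨j, h1, rfl⟩
      exact ⟨by omega, j, by omega⟩
  rw [this, sum_image]
  intro a _ b _ h
  simp only at h
  omega

lemma Bsum_dbl (f : UnitAddCircle → ℝ) (a : UnitAddCircle) (j : ℕ) (x : UnitAddCircle) :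
    Bsum f a (2 * j) x = Bsum (fun z => f z + f (z + a)) (2 • a) j x := by
  induction j with
  | zero => simp [Bsum_zero]
  | succ j ih =>
    rw [show 2 * (j + 1) = 2 * j + 1 + 1 by ring, Bsum_succ, Bsum_succ, Bsum_succ, ih, add_assoc,
      ← mul_smul, mul_comm j 2, add_smul (2 * j) 1, one_smul, add_assoc x]

lemma Bsum_dbl1 (f : UnitAddCircle → ℝ) (a : UnitAddCircle) (j : ℕ) (x : UnitAddCircle) :
    Bsum f a (2 * j + 1) x = f x + Bsum (fun z => f z + f (z + a)) (2 • a) j (x + a) := by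
  rw [add_comm (2 * j) 1, Bsum_add, ← Bsum_dbl, one_smul]
  congr 1
  simp [Bsum]

lemma even_arith {A B I e φx D ε : ℝ} (hε : 0 < ε) (he0 : -1 ≤ e) (he1 : e ≤ 0)
    (hD : |φx - I| ≤ D) (hB : 2 ≤ B) (hBD : 8 * D / ε ≤ B) (h : |A / B - I| < ε / 4) :
    |(A + e * φx) / (B + e) - I| < ε := by
  have hBp : 0 < B := by linarith
  have hBe : 0 < B + e := by linarith
  have h1 : A / B - I = (A - I * B) / B := by field_simp
  rw [h1, abs_div, abs_of_pos hBp, div_lt_iff₀ hBp] at h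
  have h2 : (A + e * φx) / (B + e) - I = (A - I * B + e * (φx - I)) / (B + e) := by
    field_simp; ring
  rw [h2, abs_div, abs_of_pos hBe, div_lt_iff₀ hBe]
  have h3 : |e * (φx - I)| ≤ D := by
    rw [abs_mul]
    have : |e| ≤ 1 := abs_le.2 ⟨he0, by linarith⟩
    calc |e| * |φx - I| ≤ 1 * D := mul_le_mul this hD (abs_nonneg _) zero_le_one
      _ = D := one_mul D
  have h4 := abs_add_le (A - I * B) (e * (φx - I))
  have h5 : 8 * D ≤ B * ε := (div_le_iff₀ hε).1 hBD
  nlinarith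

/-- Proposition 1: if `𝔣` is continuous of bounded variation with
`∫_𝕋 𝔣 = 0` and `μ⋆` is the unique stationary measure of the kernel
`p(x,·) = 𝔭(x)δ_{x+α} + 𝔮(x)δ_{x-α}`, then for every continuous `φ` and `ε > 0` there
is `q₀` such that for every close return time `q ≥ q₀` of `α` and every `x ∈ 𝕋`,
`|∫ φ dν_{x,q}^{odd} - ∫ φ dμ⋆| < ε` and `|∫ φ dν_{x,q}^{even} - ∫ φ dμ⋆| < ε`, where
`ν_{x,q}^{odd/even} = (1/M_{x,q}^{odd/even}) Σ_{0≤k<q, k odd/even} μ_{x,k} δ_{x+kα}`. -/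
theorem statement2 (α : ℝ) (hα : Irrational α) (𝔣 : UnitAddCircle → ℝ)
    (h𝔣 : ZeroMeanBV 𝔣) (μstar : Measure UnitAddCircle)
    (hμ : IsUniqueStationary (pOf 𝔣) α μstar)
    (φ : C(UnitAddCircle, ℝ)) (ε : ℝ) (hε : 0 < ε) :
    ∃ q₀ : ℕ, ∀ q : ℕ, q₀ ≤ q → CloseReturnTime α q →
      ∀ (x : UnitAddCircle) (Ω : Type) [MeasurableSpace Ω] (ℙ : Measure Ω)
        (ξ : ℕ → Ω → ℤ), IsQPWalk (pOf 𝔣) α x 0 ℙ ξ →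
        |(∑ k ∈ (Finset.range q).filter (fun k => Odd k),
              muW ℙ ξ (k : ℤ) * φ (pt α x (k : ℤ))) /
            (∑ k ∈ (Finset.range q).filter (fun k => Odd k), muW ℙ ξ (k : ℤ)) -
            ∫ z, φ z ∂μstar| < ε ∧
        |(∑ k ∈ (Finset.range q).filter (fun k => Even k),
              muW ℙ ξ (k : ℤ) * φ (pt α x (k : ℤ))) /
            (∑ k ∈ (Finset.range q).filter (fun k => Even k), muW ℙ ξ (k : ℤ)) -
            ∫ z, φ z ∂μstar| < ε := by
  obtain ⟨hf, hbv, h0⟩ := id h𝔣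
  obtain ⟨v, V, hv⟩ := exists_QPv 𝔣 hbv
  have hβ : Irrational (2 * α) := by exact_mod_cast hα.natCast_mul two_ne_zero
  obtain ⟨g, hgdef⟩ : ∃ g, g = fun z => 𝔣 z + 𝔣 (z + (α : UnitAddCircle)) := ⟨_, rfl⟩
  obtain ⟨b, hb⟩ : ∃ b, b = ((2 * α : ℝ) : UnitAddCircle) := ⟨_, rfl⟩
  have hb2 : 2 • (α : UnitAddCircle) = b := by rw [hb, ← AddCircle.coe_nsmul]; simp
  have hg := QPv_double hv α
  rw [← hgdef] at hg
  have hgc : Continuous g := by rw [hgdef]; fun_prop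
  have hg0 : ∫ z, g z = 0 := by
    rw [hgdef, integral_add (int_of_cont hf) (int_of_cont (by fun_prop)),
      integral_add_right_eq_self (μ := (volume : Measure UnitAddCircle)) 𝔣, h0, add_zero]
  obtain ⟨J1, hJ1⟩ := core hα h𝔣 hμ φ (ε / 4) (by positivity) hgdef hb
  set I := ∫ z, φ z ∂μstar with hI
  obtain ⟨M, hM⟩ : ∃ M, ∀ z, 𝔣 z ≤ M := by
    obtain ⟨M, hM⟩ := (isCompact_range hf).bddAbove
    exact ⟨M, fun z => hM ⟨z, rfl⟩⟩
  set D := ‖φ‖ + |I| with hD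
  have hD0 : 0 ≤ D := by positivity
  obtain ⟨J2, hJ2⟩ := growth hβ hg hgc hg0 ((1 + Real.exp M) * (2 + 8 * D / ε))
  rw [← hb] at hJ2
  refine ⟨2 * (J1 + J2 + 1), fun q hq _ x Ω _ ℙ ξ hw => ⟨?_, ?_⟩⟩
  · rw [sum_odd q (fun k => muW ℙ ξ (k : ℤ) * φ (pt α x (k : ℤ))), sum_odd q (fun k => muW ℙ ξ (k : ℤ))]
    have hc := hJ1 (q / 2) (by omega) (x + α)
    have hcp : 0 < (1 - pOf 𝔣 x) * Real.exp (𝔣 x) := mul_pos (one_sub_pOf_pos 𝔣 x) (Real.exp_pos _)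
    have hsm : ∀ j : ℕ, x + (2 * j + 1) • (α : UnitAddCircle) = x + α + j • b := fun j => by
      rw [← hb2, add_smul, mul_comm 2 j, mul_smul, one_smul]; abel
    have hwt : ∀ j : ℕ, muW ℙ ξ ((2 * j + 1 : ℕ) : ℤ) = ((1 - pOf 𝔣 x) * Real.exp (𝔣 x)) *
        (Real.exp (Bsum g b j (x + α)) * (1 + Real.exp (𝔣 (x + α + j • b)))) := fun j => by
      rw [muW_eq hα h𝔣 hw (2 * j), Bsum_dbl1, ← hgdef, hb2, Real.exp_add, hsm]; ring
    simp only [hwt, pt_nat, hsm]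
    simp only [mul_assoc _ (Real.exp (Bsum _ _ _ _) * _) _]
    rw [← mul_sum, ← mul_sum, mul_div_mul_left _ _ hcp.ne']
    linarith
  · rw [sum_even q (fun k => muW ℙ ξ (k : ℤ) * φ (pt α x (k : ℤ))), sum_even q (fun k => muW ℙ ξ (k : ℤ))]
    have hc := hJ1 ((q + 1) / 2) (by omega) x
    have hgr := (hJ2 ((q + 1) / 2) (by omega) x).1
    set c := 1 - pOf 𝔣 x with hcdef
    have hcp : 0 < c := one_sub_pOf_pos 𝔣 x
    have hcM : 1 ≤ c * (1 + Real.exp M) := by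
      rw [hcdef, one_sub_pOf, div_mul_eq_mul_div, one_mul, one_le_div (by positivity)]
      have := Real.exp_le_exp.2 (hM x)
      linarith
    have hsm : ∀ j : ℕ, x + (2 * j) • (α : UnitAddCircle) = x + j • b := fun j => by
      rw [← hb2, mul_comm 2 j, mul_smul]
    let w : ℕ → ℝ := fun j => Real.exp (Bsum g b j x) * (1 + Real.exp (𝔣 (x + j • b)))
    have hw0 : c * w 0 = 1 := by
      simp only [w, Bsum_zero, Real.exp_zero, zero_smul, add_zero, one_mul, hcdef, one_sub_pOf]
      field_simp
    have hwt : ∀ j : ℕ, muW ℙ ξ ((2 * (j + 1) : ℕ) : ℤ) = c * w (j + 1) := fun j => by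
      have := muW_eq hα h𝔣 hw (2 * j + 1)
      rw [show 2 * j + 1 + 1 = 2 * (j + 1) by ring, Bsum_dbl, ← hgdef, hb2, hsm] at this
      exact this
    obtain ⟨hm0, hm1⟩ := muW_zero hw
    obtain ⟨L, hL⟩ : ∃ L, (q + 1) / 2 = L + 1 := ⟨(q + 1) / 2 - 1, by omega⟩
    rw [hL] at hc hgr ⊢
    have e1 : ∑ j ∈ range (L + 1), muW ℙ ξ ((2 * j : ℕ) : ℤ) =
        c * ∑ j ∈ range (L + 1), w j + (muW ℙ ξ 0 - 1) := by
      rw [sum_range_succ', sum_range_succ', mul_add, hw0, mul_sum]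
      simp only [hwt]
      simp
    have e2 : ∑ j ∈ range (L + 1), muW ℙ ξ ((2 * j : ℕ) : ℤ) * φ (pt α x ((2 * j : ℕ) : ℤ)) =
        c * ∑ j ∈ range (L + 1), w j * φ (x + j • b) + (muW ℙ ξ 0 - 1) * φ x := by
      simp only [pt_nat, hsm]
      rw [sum_range_succ', sum_range_succ', mul_add, ← mul_assoc c, hw0, mul_sum]
      simp only [hwt, mul_assoc]
      simp only [mul_zero, Nat.cast_zero, zero_smul, add_zero]
      ring
    rw [e1, e2]
    have hBig : 2 + 8 * D / ε ≤ c * ∑ j ∈ range (L + 1), w j := by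
      have h1 : ∑ j ∈ range (L + 1), Real.exp (Bsum g b j x) ≤ ∑ j ∈ range (L + 1), w j :=
        sum_le_sum fun j _ => le_mul_of_one_le_right (Real.exp_pos _).le
          (by linarith [Real.exp_pos (𝔣 (x + j • b))])
      have h2 : 0 ≤ 2 + 8 * D / ε := by positivity
      calc 2 + 8 * D / ε ≤ c * (1 + Real.exp M) * (2 + 8 * D / ε) := le_mul_of_one_le_left h2 hcM
        _ = c * ((1 + Real.exp M) * (2 + 8 * D / ε)) := by ring
        _ ≤ _ := mul_le_mul_of_nonneg_left (hgr.trans h1) hcp.le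
    have h8 : 0 ≤ 8 * D / ε := by positivity
    refine even_arith hε (by linarith) (by linarith) (D := D) ?_ (by linarith) (by linarith) ?_
    · refine (abs_sub _ _).trans ?_
      have := φ.norm_coe_le_norm x
      rw [Real.norm_eq_abs] at this
      rw [hD]; linarith
    · rw [mul_div_mul_left _ _ hcp.ne']
      exact hc
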